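/- arXiv:math/9802111 — 2 statements merged into one kernel-verified Lean document; each statement's English description precedes it below -/
import Mathlib

section
/- For Kostka numbers indexed by compositions: for partitions η and λ with at most n parts and |η| = |λ|, the alternating sum ∑_{τ ∈ S_n} ε(τ) K_{η, (λ_1+τ(1)−1, λ_2+τ(2)−2, ..., λ_n+τ(n)−n)} equals 1 if η = λ and 0 otherwise. -/
/-- `T : ℕ → ℕ → ℕ` is a semistandard Young tableau of shape `η` (rows indexed from 0,
French convention) over the alphabet `{1,…,n}`, with content `lam` (as a composition):
supported on the cells of `η`, rows weakly increase, columns strictly increase, and the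
number of entries equal to `k+1` is `lam k`. -/
def IsTabGrid (n : ℕ) (η : ℕ → ℕ) (lam : Fin n → ℕ) (T : ℕ → ℕ → ℕ) : Prop :=
  (∀ r c, ¬ c < η r → T r c = 0) ∧
  (∀ r c, c < η r → 1 ≤ T r c ∧ T r c ≤ n) ∧
  (∀ r c, c + 1 < η r → T r c ≤ T r (c + 1)) ∧
  (∀ r c, c < η (r + 1) → T r c < T (r + 1) c) ∧
  (∀ k : Fin n, Set.ncard {p : ℕ × ℕ | p.2 < η p.1 ∧ T p.1 p.2 = (k : ℕ) + 1} = lam k)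

/-- The Kostka number `K_{η,ν}`: the number of semistandard Young tableaux of shape `η`
and content the composition `ν`. -/
noncomputable def kostka (n : ℕ) (η : ℕ → ℕ) (ν : Fin n → ℕ) : ℕ :=
  Set.ncard {T : ℕ → ℕ → ℕ | IsTabGrid n η ν T}

/-- The Kostka number with a possibly negative integer content: zero if any component
is negative. -/
noncomputable def kostkaZ (n : ℕ) (η : ℕ → ℕ) (ν : Fin n → ℤ) : ℕ :=
  if ∀ i, 0 ≤ ν i then kostka n η (fun i => (ν i).toNat) else 0

/-- A partition `η : Fin n → ℕ` viewed as a shape function `ℕ → ℕ`. -/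
def shapeOf (n : ℕ) (η : Fin n → ℕ) : ℕ → ℕ :=
  fun m => if h : m < n then η ⟨m, h⟩ else 0


theorem kas_det_reduce {R : Type*} [CommRing R] (n : ℕ) (A : Matrix (Fin (n+1)) (Fin (n+1)) R)
    (c : Fin n → R) (h : ∀ j, A (Fin.last n) j.castSucc = c j * A (Fin.last n) j.succ) :
    A.det = A (Fin.last n) (Fin.last n) *
      Matrix.det (Matrix.of fun i j : Fin n => A i.castSucc j.castSucc - c j * A i.castSucc j.succ) := by
  let A' : Matrix (Fin (n+1)) (Fin (n+1)) R := A.submatrix Fin.revPerm Fin.revPerm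
  let B' : Matrix (Fin (n+1)) (Fin (n+1)) R := fun i j =>
    Fin.cases (A' i 0) (fun j => A' i j.succ - c j.rev * A' i j.castSucc) j
  have h1 : A.det = A'.det := (Matrix.det_submatrix_equiv_self _ _).symm
  have h2 : A'.det = B'.det := by
    apply Matrix.det_eq_of_forall_col_eq_smul_add_pred (fun j => c j.rev)
    · intro i; rfl
    · intro i j; simp [B']
  have h3 : ∀ j : Fin n, B' 0 j.succ = 0 := by
    intro j
    simp [B', A', h, Fin.rev_succ, Fin.rev_castSucc]
  rw [h1, h2, Matrix.det_succ_row_zero, Fin.sum_univ_succ]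
  simp only [h3]
  simp only [Fin.val_zero, pow_zero, one_mul, mul_zero, zero_mul, Finset.sum_const_zero, add_zero]
  have h4 : B' 0 0 = A (Fin.last n) (Fin.last n) := by simp [B', A']
  rw [h4]
  congr 1
  rw [← Matrix.det_submatrix_equiv_self (Fin.revPerm (n := n))]
  congr 1
  ext i j
  show A (Fin.rev (Fin.succ (Fin.rev i))) (Fin.rev (Fin.succ (Fin.rev j))) -
    c (Fin.rev (Fin.rev j)) * A (Fin.rev (Fin.succ (Fin.rev i))) (Fin.rev (Fin.castSucc (Fin.rev j))) = _
  simp [Fin.rev_succ, Fin.rev_castSucc]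

/-- The alternant. -/
def kasD {R : Type*} [CommRing R] (n : ℕ) (x : Fin n → R) (η : Fin n → ℕ) : R :=
  Matrix.det (Matrix.of fun i j : Fin n => x i ^ (η j + (j.rev : ℕ)))

/-- Interlacing vectors. -/
def kasP (n : ℕ) (η : Fin (n+1) → ℕ) : Finset (Fin n → ℕ) :=
  Fintype.piFinset fun j : Fin n => Finset.Icc (η j.succ) (η j.castSucc)

theorem kas_geom {R : Type*} [CommRing R] (x y : R) (a b r : ℕ) (h : b ≤ a) :
    x ^ (a + (r+1)) - y ^ (a + 1 - b) * x ^ (b + r) =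
      (x - y) * ∑ m ∈ Finset.Icc b a, y ^ (a - m) * x ^ (m + r) := by
  obtain ⟨d, rfl⟩ := Nat.exists_eq_add_of_le h
  have := geom_sum₂_mul x y (d+1)
  have e : ∑ m ∈ Finset.Icc b (b+d), y ^ (b + d - m) * x ^ (m + r) =
    x ^ (b + r) * ∑ i ∈ Finset.range (d+1), x ^ i * y ^ (d + 1 - 1 - i) := by
    rw [← Finset.Ico_add_one_right_eq_Icc, Finset.sum_Ico_eq_sum_range, Finset.mul_sum,
      show b + d + 1 - b = d + 1 by omega]
    refine Finset.sum_congr rfl fun i hi => ?_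
    rw [show b + d - (b + i) = d + 1 - 1 - i by omega]
    ring
  rw [e, show b + d + 1 - b = d + 1 by omega]
  linear_combination (-x^(b+r)) * this

theorem kas_D_succ {R : Type*} [CommRing R] (n : ℕ) (x : Fin (n+1) → R) (η : Fin (n+1) → ℕ)
    (hη : Antitone η) :
    kasD (n+1) x η = (∏ i : Fin n, (x i.castSucc - x (Fin.last n))) *
      ∑ μ ∈ kasP n η, x (Fin.last n) ^ (∑ i, η i - ∑ i, μ i) * kasD n (fun i => x i.castSucc) μ := by
  set y := x (Fin.last n) with hy
  have hle : ∀ j : Fin n, η j.succ ≤ η j.castSucc := fun j => hη (Fin.castSucc_lt_succ).le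
  unfold kasD
  rw [kas_det_reduce n _ (fun j => y ^ (η j.castSucc + 1 - η j.succ))]
  swap
  · intro j
    have := hle j
    simp only [Matrix.of_apply, Fin.rev_castSucc, Fin.rev_succ, Fin.val_succ, Fin.val_castSucc]
    rw [← hy, ← pow_add]
    congr 1
    omega
  have e : (Matrix.of fun i j : Fin n => (Matrix.of fun i j : Fin (n+1) => x i ^ (η j + (j.rev : ℕ))) i.castSucc j.castSucc
      - y ^ (η j.castSucc + 1 - η j.succ) * (Matrix.of fun i j : Fin (n+1) => x i ^ (η j + (j.rev : ℕ))) i.castSucc j.succ)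
      = Matrix.of fun i j : Fin n => (x i.castSucc - y) * (Matrix.of fun i j : Fin n => 
        ∑ m ∈ Finset.Icc (η j.succ) (η j.castSucc), y ^ (η j.castSucc - m) * x i.castSucc ^ (m + (j.rev : ℕ))) i j := by
    ext i j
    simp only [Matrix.of_apply, Fin.rev_castSucc, Fin.rev_succ, Fin.val_succ, Fin.val_castSucc]
    exact kas_geom _ _ _ _ _ (hle j)
  rw [e, Matrix.det_mul_column]
  have e2 : (Matrix.of fun i j : Fin n => 
        ∑ m ∈ Finset.Icc (η j.succ) (η j.castSucc), y ^ (η j.castSucc - m) * x i.castSucc ^ (m + (j.rev : ℕ))).det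
      = ∑ μ ∈ kasP n η, (Matrix.of fun i j : Fin n => y ^ (η j.castSucc - μ j) * (Matrix.of fun i j : Fin n => x i.castSucc ^ (μ j + (j.rev : ℕ))) i j).det := by
    have := (Matrix.detRowAlternating (n := Fin n) (R := R)).toMultilinearMap.map_sum_finset
      (fun j m => fun i => y ^ (η j.castSucc - m) * x i.castSucc ^ (m + (j.rev : ℕ))) 
      (fun j => Finset.Icc (η j.succ) (η j.castSucc))
    rw [← Matrix.det_transpose]
    refine Eq.trans ?_ (this.trans ?_)
    · show Matrix.det _ = Matrix.det _
      congr 1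
      ext i j
      simp
    · refine Finset.sum_congr rfl fun μ _ => ?_
      rw [← Matrix.det_transpose]
      rfl
  rw [e2, mul_left_comm, Finset.mul_sum]
  congr 1
  refine Finset.sum_congr rfl fun μ hμ => ?_
  rw [Matrix.det_mul_row, ← mul_assoc]
  congr 1
  have hμ' : ∀ j, μ j ≤ η j.castSucc := fun j => by
    have := Fintype.mem_piFinset.1 hμ j
    exact (Finset.mem_Icc.1 this).2
  rw [Finset.prod_pow_eq_pow_sum]
  simp only [Matrix.of_apply, Fin.rev_last, Fin.val_zero, add_zero]
  rw [← hy, ← pow_add]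
  congr 1
  rw [Fin.sum_univ_castSucc]
  have : ∑ j, (η j.castSucc - μ j) + ∑ j, μ j = ∑ j : Fin n, η j.castSucc := by
    rw [← Finset.sum_add_distrib]
    exact Finset.sum_congr rfl fun j _ => Nat.sub_add_cancel (hμ' j)
  omega
/-- Tableau without content condition. -/
def kasTab (n : ℕ) (η : ℕ → ℕ) (T : ℕ → ℕ → ℕ) : Prop :=
  (∀ r c, ¬ c < η r → T r c = 0) ∧
  (∀ r c, c < η r → 1 ≤ T r c ∧ T r c ≤ n) ∧
  (∀ r c, c + 1 < η r → T r c ≤ T r (c + 1)) ∧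
  (∀ r c, c < η (r + 1) → T r c < T (r + 1) c)

/-- Content. -/
noncomputable def kasCont (η : ℕ → ℕ) (T : ℕ → ℕ → ℕ) (k : ℕ) : ℕ :=
  Set.ncard {p : ℕ × ℕ | p.2 < η p.1 ∧ T p.1 p.2 = k + 1}

/-- Extend a tableau by the letter `n+1`. -/
def kasExt (n : ℕ) (η μ : ℕ → ℕ) (T : ℕ → ℕ → ℕ) : ℕ → ℕ → ℕ :=
  fun r c => if c < μ r then T r c else if c < η r then n + 1 else 0

theorem kas_shape_anti (n : ℕ) (η : Fin n → ℕ) (h : Antitone η) : Antitone (shapeOf n η) := by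
  intro a b hab
  unfold shapeOf
  split_ifs with h1 h2
  · exact h (by simpa using hab)
  · omega
  · exact Nat.zero_le _
  · exact le_rfl

theorem kas_shape_zero (n : ℕ) (η : Fin n → ℕ) (r : ℕ) (h : n ≤ r) : shapeOf n η r = 0 := by
  unfold shapeOf; rw [dif_neg (by omega)]

theorem kas_shape_val (n : ℕ) (η : Fin n → ℕ) (r : Fin n) : shapeOf n η r = η r := by
  unfold shapeOf; simp

theorem kas_P_anti (n : ℕ) (η : Fin (n+1) → ℕ) (hη : Antitone η) (μ : Fin n → ℕ)
    (hμ : μ ∈ kasP n η) : Antitone μ := by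
  intro a b hab
  rcases hab.eq_or_lt with rfl | hab
  · exact le_rfl
  have h1 := Finset.mem_Icc.1 (Fintype.mem_piFinset.1 hμ a)
  have h2 := Finset.mem_Icc.1 (Fintype.mem_piFinset.1 hμ b)
  refine h2.2.trans (le_trans (hη ?_) h1.1)
  rw [Fin.le_def]; simp only [Fin.val_succ, Fin.val_castSucc]; exact hab

theorem kas_P_shape (n : ℕ) (η : Fin (n+1) → ℕ) (μ : Fin n → ℕ)
    (hμ : μ ∈ kasP n η) (r : ℕ) : shapeOf (n+1) η (r+1) ≤ shapeOf n μ r ∧ shapeOf n μ r ≤ shapeOf (n+1) η r := by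
  by_cases hr : r < n
  · have h1 := Finset.mem_Icc.1 (Fintype.mem_piFinset.1 hμ ⟨r, hr⟩)
    have e1 := kas_shape_val (n+1) η (Fin.succ ⟨r, hr⟩)
    have e2 := kas_shape_val (n+1) η (Fin.castSucc ⟨r, hr⟩)
    have e3 := kas_shape_val n μ ⟨r, hr⟩
    simp only [Fin.val_succ, Fin.val_castSucc] at e1 e2 e3
    rw [e1, e2, e3]; exact h1
  · rw [kas_shape_zero n μ r (by omega), kas_shape_zero (n+1) η (r+1) (by omega)]
    simp

theorem kas_ext_tab (n : ℕ) (η μ : ℕ → ℕ) (T : ℕ → ℕ → ℕ) (hη : Antitone η)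
    (h1 : ∀ r, η (r+1) ≤ μ r) (h2 : ∀ r, μ r ≤ η r) (hT : kasTab n μ T) :
    kasTab (n+1) η (kasExt n η μ T) := by
  obtain ⟨t1, t2, t3, t4⟩ := hT
  refine ⟨?_, ?_, ?_, ?_⟩
  · intro r c h
    have := h2 r
    simp only [kasExt]
    rw [if_neg (by omega), if_neg h]
  · intro r c h
    have := t2 r c
    simp only [kasExt]
    split_ifs <;> grind
  · intro r c h
    have := t2 r c
    have := t3 r c
    have := h2 r
    simp only [kasExt]
    split_ifs <;> grind
  · intro r c h
    have := t2 r c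
    have := t4 r c
    have := h1 r
    simp only [kasExt]
    split_ifs <;> grind

theorem kas_ext_inj (n : ℕ) (η μ μ' : ℕ → ℕ) (T T' : ℕ → ℕ → ℕ)
    (h2 : ∀ r, μ r ≤ η r) (h2' : ∀ r, μ' r ≤ η r) (hT : kasTab n μ T) (hT' : kasTab n μ' T')
    (h : kasExt n η μ T = kasExt n η μ' T') : T = T' ∧ μ = μ' := by
  have key : ∀ r c, (c < μ r ↔ c < μ' r) := by
    intro r c
    have e := congrFun (congrFun h r) c
    have a := hT.2.1 r c
    have a' := hT'.2.1 r c
    have := h2 r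
    have := h2' r
    simp only [kasExt] at e
    split_ifs at e <;> grind
  have hm : μ = μ' := by
    funext r
    exact le_antisymm (le_of_forall_lt fun c hc => (key r c).1 hc) (le_of_forall_lt fun c hc => (key r c).2 hc)
  refine ⟨?_, hm⟩
  funext r c
  have e := congrFun (congrFun h r) c
  have a := hT.1 r c
  have a' := hT'.1 r c
  have := key r c
  simp only [kasExt] at e
  split_ifs at e <;> grind

theorem kas_row (m n : ℕ) (f : ℕ → ℕ) (h : ∀ c, c + 1 < m → f c ≤ f (c+1)) :
    ∃ k, ∀ c, c < k ↔ c < m ∧ f c ≤ n := by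
  induction m with
  | zero => exact ⟨0, by simp⟩
  | succ m ih =>
    obtain ⟨k, hk⟩ := ih fun c hc => h c (by omega)
    by_cases hm : f m ≤ n
    · refine ⟨m+1, fun c => ⟨fun hc => ⟨hc, ?_⟩, fun hc => hc.1⟩⟩
      have : ∀ d, d ≤ m → f (m - d) ≤ n := by
        intro d
        induction d with
        | zero => intro _; simpa using hm
        | succ d ihd =>
          intro hd
          have := h (m - (d+1)) (by omega)
          rw [show m - (d+1) + 1 = m - d by omega] at this
          exact this.trans (ihd (by omega))
      have := this (m - c) (by omega)
      rwa [show m - (m - c) = c by omega] at this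
    · refine ⟨k, fun c => ?_⟩
      rw [hk]
      constructor
      · rintro ⟨a, b⟩; exact ⟨by omega, b⟩
      · rintro ⟨a, b⟩
        refine ⟨?_, b⟩
        rcases Nat.lt_succ_iff_lt_or_eq.1 a with a | rfl
        · exact a
        · exact absurd b hm

theorem kas_entry_lb (n : ℕ) (η : ℕ → ℕ) (T : ℕ → ℕ → ℕ) (hη : Antitone η) (hT : kasTab n η T)
    (r c : ℕ) (h : c < η r) : r + 1 ≤ T r c := by
  induction r with
  | zero => exact (hT.2.1 0 c h).1
  | succ r ih =>
    have := ih (h.trans_le (hη (Nat.le_succ r)))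
    have := hT.2.2.2 r c h
    omega

theorem kas_tab_ext (n : ℕ) (η : Fin (n+1) → ℕ) (T : ℕ → ℕ → ℕ) (hη : Antitone η)
    (hT : kasTab (n+1) (shapeOf (n+1) η) T) :
    ∃ μ ∈ kasP n η, ∃ T', kasTab n (shapeOf n μ) T' ∧
      kasExt n (shapeOf (n+1) η) (shapeOf n μ) T' = T := by
  have hs := kas_shape_anti _ η hη
  have lb := kas_entry_lb _ _ T hs hT
  obtain ⟨t1, t2, t3, t4⟩ := hT
  choose m hm using fun r => kas_row (shapeOf (n+1) η r) n (T r) (t3 r)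
  have hμ : shapeOf n (fun i => m i) = m := by
    funext r
    by_cases hr : r < n
    · simp [shapeOf, hr]
    · rw [kas_shape_zero _ _ _ (by omega)]
      by_contra h0
      have h1 := (hm r 0).1 (by omega)
      have := lb r 0 h1.1
      omega
  refine ⟨fun i => m i, ?_, fun r c => if T r c ≤ n then T r c else 0, ?_, ?_⟩
  · refine Fintype.mem_piFinset.2 fun j => Finset.mem_Icc.2 ⟨?_, ?_⟩
    · rw [← kas_shape_val (n+1) η, Fin.val_succ]
      refine le_of_forall_lt fun c hc => (hm _ _).2 ⟨hc.trans_le (hs (Nat.le_succ _)), ?_⟩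
      have := t4 _ _ hc
      have := t2 _ _ hc
      omega
    · rw [← kas_shape_val (n+1) η, Fin.val_castSucc]
      exact le_of_forall_lt fun c hc => ((hm _ _).1 hc).1
  · rw [hμ]
    refine ⟨?_, ?_, ?_, ?_⟩
    · intro r c h
      have := hm r c
      have := t1 r c
      grind
    · intro r c h
      have := hm r c
      have := t2 r c
      grind
    · intro r c h
      have := hm r c
      have := hm r (c+1)
      have := t3 r c
      grind
    · intro r c h
      have := hm (r+1) c
      have := t4 r c
      grind
  · rw [hμ]
    funext r c
    have := hm r c
    have := t1 r c
    have := t2 r c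
    simp only [kasExt]
    grind

/-- The finset of tableaux. -/
noncomputable def kasF : (n : ℕ) → (Fin n → ℕ) → Finset (ℕ → ℕ → ℕ)
  | 0, _ => {fun _ _ => 0}
  | n+1, η => open Classical in (kasP n η).biUnion fun μ =>
      (kasF n μ).image (kasExt n (shapeOf (n+1) η) (shapeOf n μ))

theorem kas_mem_F (n : ℕ) : ∀ (η : Fin n → ℕ) (_ : Antitone η) (T : ℕ → ℕ → ℕ),
    T ∈ kasF n η ↔ kasTab n (shapeOf n η) T := by
  induction n with
  | zero =>
    intro η _ T
    have : ∀ r, shapeOf 0 η r = 0 := fun r => kas_shape_zero _ _ _ (Nat.zero_le _)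
    simp only [kasF, Finset.mem_singleton, kasTab, this]
    constructor
    · rintro rfl; simp
    · rintro ⟨h, -⟩; funext r c; exact h r c (by simp)
  | succ n ih =>
    intro η hη T
    simp only [kasF, Finset.mem_biUnion, Finset.mem_image]
    constructor
    · rintro ⟨μ, hμ, T', hT', rfl⟩
      rw [ih μ (kas_P_anti n η hη μ hμ)] at hT'
      exact kas_ext_tab n _ _ _ (kas_shape_anti _ _ hη) (fun r => (kas_P_shape n η μ hμ r).1)
        (fun r => (kas_P_shape n η μ hμ r).2) hT'
    · intro h
      obtain ⟨μ, hμ, T', hT', e⟩ := kas_tab_ext n η T hη h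
      exact ⟨μ, hμ, T', (ih μ (kas_P_anti n η hη μ hμ) _).2 hT', e⟩

theorem kas_shape_inj (n : ℕ) (μ μ' : Fin n → ℕ) (h : shapeOf n μ = shapeOf n μ') : μ = μ' := by
  funext i
  rw [← kas_shape_val n μ, ← kas_shape_val n μ', h]

theorem kas_sum_F {R : Type*} [CommRing R] (n : ℕ) (η : Fin (n+1) → ℕ) (hη : Antitone η)
    (w : (ℕ → ℕ → ℕ) → R) :
    ∑ T ∈ kasF (n+1) η, w T = ∑ μ ∈ kasP n η, ∑ T ∈ kasF n μ,
      w (kasExt n (shapeOf (n+1) η) (shapeOf n μ) T) := by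
  classical
  have key : ∀ μ ∈ kasP n η, ∀ μ' ∈ kasP n η, ∀ T ∈ kasF n μ, ∀ T' ∈ kasF n μ',
      kasExt n (shapeOf (n+1) η) (shapeOf n μ) T = kasExt n (shapeOf (n+1) η) (shapeOf n μ') T' →
      T = T' ∧ μ = μ' := by
    intro μ hμ μ' hμ' T hT T' hT' e
    rw [kas_mem_F _ _ (kas_P_anti n η hη _ ‹_›)] at hT hT'
    have := kas_ext_inj n _ _ _ T T' (fun r => (kas_P_shape n η μ hμ r).2)
      (fun r => (kas_P_shape n η μ' hμ' r).2) hT hT' e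
    exact ⟨this.1, kas_shape_inj _ _ _ this.2⟩
  have : kasF (n+1) η = (kasP n η).biUnion fun μ =>
      (kasF n μ).image (kasExt n (shapeOf (n+1) η) (shapeOf n μ)) := by
    simp only [kasF]
  rw [this, Finset.sum_biUnion]
  · refine Finset.sum_congr rfl fun μ hμ => ?_
    rw [Finset.sum_image]
    intro T hT T' hT' e
    exact (key μ hμ μ hμ T hT T' hT' e).1
  · intro μ hμ μ' hμ' hne
    refine Finset.disjoint_left.2 fun T hT hT' => hne ?_
    obtain ⟨a, ha, rfl⟩ := Finset.mem_image.1 hT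
    obtain ⟨b, hb, e⟩ := Finset.mem_image.1 hT'
    exact (key μ hμ μ' hμ' a ha b hb e.symm).2

theorem kas_cont_lt (n : ℕ) (η μ : ℕ → ℕ) (T : ℕ → ℕ → ℕ) (h2 : ∀ r, μ r ≤ η r) (k : ℕ) (hk : k < n) :
    kasCont η (kasExt n η μ T) k = kasCont μ T k := by
  unfold kasCont
  congr 1
  ext ⟨r, c⟩
  have := h2 r
  simp only [Set.mem_ofPred_eq, kasExt]
  grind

theorem kas_cont_last (n : ℕ) (η : Fin (n+1) → ℕ) (μ : Fin n → ℕ) (hμ : μ ∈ kasP n η) (T : ℕ → ℕ → ℕ)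
    (hT : kasTab n (shapeOf n μ) T) :
    kasCont (shapeOf (n+1) η) (kasExt n (shapeOf (n+1) η) (shapeOf n μ) T) n = ∑ i, η i - ∑ i, μ i := by
  have h2 := fun r => (kas_P_shape n η μ hμ r).2
  have e : {p : ℕ × ℕ | p.2 < shapeOf (n+1) η p.1 ∧ kasExt n (shapeOf (n+1) η) (shapeOf n μ) T p.1 p.2 = n + 1}
      = ((((Finset.range (n+1)).sigma fun r => Finset.Ico (shapeOf n μ r) (shapeOf (n+1) η r)).map
        (Equiv.sigmaEquivProd ℕ ℕ).toEmbedding : Finset (ℕ × ℕ)) : Set (ℕ × ℕ)) := by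
    ext ⟨r, c⟩
    have := hT.2.1 r c
    have := h2 r
    have h3 : c < shapeOf (n+1) η r → r < n + 1 := by
      intro h
      by_contra h'
      rw [kas_shape_zero _ _ _ (by omega)] at h
      omega
    simp only [Set.mem_ofPred_eq, kasExt, Finset.coe_map, Set.mem_image, Finset.mem_coe, Finset.mem_sigma,
      Finset.mem_range, Finset.mem_Ico, Equiv.coe_toEmbedding, Sigma.exists, Equiv.sigmaEquivProd_apply,
      Prod.mk.injEq]
    constructor
    · intro h
      exact ⟨r, c, by grind, rfl, rfl⟩
    · rintro ⟨r', c', h, rfl, rfl⟩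
      grind
  unfold kasCont
  rw [e, Set.ncard_coe_finset, Finset.card_map, Finset.card_sigma]
  simp only [Nat.card_Ico]
  have e1 : ∑ r ∈ Finset.range (n+1), shapeOf (n+1) η r = ∑ i, η i := by
    rw [Finset.sum_range]; simp only [kas_shape_val]
  have e2 : ∑ r ∈ Finset.range (n+1), shapeOf n μ r = ∑ i, μ i := by
    rw [Finset.sum_range_succ, kas_shape_zero _ _ _ le_rfl, Finset.sum_range]; simp only [kas_shape_val, add_zero]
  rw [← e1, ← e2]
  exact Finset.sum_tsub_distrib _ (fun r _ => h2 r)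

theorem kas_main {R : Type*} [CommRing R] (n : ℕ) : ∀ (x : Fin n → R) (η : Fin n → ℕ), Antitone η →
    kasD n x 0 * ∑ T ∈ kasF n η, ∏ k : Fin n, x k ^ kasCont (shapeOf n η) T k = kasD n x η := by
  induction n with
  | zero => intro x η _; simp [kasD, kasF]
  | succ n ih =>
    intro x η hη
    have h0 : kasP n 0 = {0} := by
      ext μ
      simp [kasP, Fintype.mem_piFinset, funext_iff]
    rw [kas_D_succ n x 0 (fun _ _ _ => le_rfl), kas_D_succ n x η hη, h0, kas_sum_F n η hη]
    simp only [Finset.sum_singleton, Pi.zero_apply, Finset.sum_const_zero, Nat.sub_self, pow_zero, one_mul]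
    rw [mul_assoc, Finset.mul_sum]
    congr 1
    refine Finset.sum_congr rfl fun μ hμ => ?_
    rw [← ih _ μ (kas_P_anti n η hη μ hμ), mul_left_comm]
    congr 1
    rw [Finset.mul_sum]
    refine Finset.sum_congr rfl fun T hT => ?_
    rw [kas_mem_F _ _ (kas_P_anti n η hη μ hμ)] at hT
    rw [Fin.prod_univ_castSucc, mul_comm]
    simp only [Fin.val_last, Fin.val_castSucc]
    rw [kas_cont_last n η μ hμ T hT]
    congr 1
    refine Finset.prod_congr rfl fun k _ => ?_
    rw [kas_cont_lt n _ _ _ (fun r => (kas_P_shape n η μ hμ r).2) k k.2]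

theorem kas_monomial (n : ℕ) (f : Fin n → ℕ) :
    ∏ k : Fin n, (MvPolynomial.X k : MvPolynomial (Fin n) ℤ) ^ f k =
      MvPolynomial.monomial (Finsupp.equivFunOnFinite.symm f) 1 := by
  rw [MvPolynomial.monomial_eq, Finsupp.prod_fintype _ _ (by simp)]
  simp

theorem kas_kostka (n : ℕ) (η : Fin n → ℕ) (hη : Antitone η) (ν : Fin n →₀ ℕ) :
    (MvPolynomial.coeff ν (∑ T ∈ kasF n η, ∏ k : Fin n,
      (MvPolynomial.X k : MvPolynomial (Fin n) ℤ) ^ kasCont (shapeOf n η) T k))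
      = (kostka n (shapeOf n η) ν : ℤ) := by
  classical
  have e : {T | IsTabGrid n (shapeOf n η) ν T} =
      (((kasF n η).filter fun T => Finsupp.equivFunOnFinite.symm (fun k : Fin n => kasCont (shapeOf n η) T k) = ν : Finset _) : Set (ℕ → ℕ → ℕ)) := by
    ext T
    simp only [Set.mem_ofPred_eq, Finset.coe_filter, kas_mem_F n η hη, IsTabGrid, kasTab, and_assoc,
      Finsupp.ext_iff, Finsupp.equivFunOnFinite_symm_apply_apply, kasCont]
  unfold kostka
  rw [e, Set.ncard_coe_finset, MvPolynomial.coeff_sum, Finset.card_filter]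
  push_cast
  refine Finset.sum_congr rfl fun T _ => ?_
  rw [kas_monomial, MvPolynomial.coeff_monomial]

theorem kas_D_X (n : ℕ) (η : Fin n → ℕ) :
    kasD n (MvPolynomial.X : Fin n → MvPolynomial (Fin n) ℤ) η =
      ∑ σ : Equiv.Perm (Fin n), MvPolynomial.monomial
        (Finsupp.equivFunOnFinite.symm fun i => η (σ i) + ((σ i).rev : ℕ)) ((Equiv.Perm.sign σ : ℤˣ) : ℤ) := by
  unfold kasD
  rw [← Matrix.det_transpose, Matrix.det_apply']
  refine Finset.sum_congr rfl fun σ _ => ?_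
  simp only [Matrix.transpose_apply, Matrix.of_apply]
  rw [kas_monomial n (fun i => η (σ i) + ((σ i).rev : ℕ))]
  have := MvPolynomial.C_mul_monomial (σ := Fin n) (a := ((Equiv.Perm.sign σ : ℤˣ) : ℤ)) (a' := 1)
    (s := Finsupp.equivFunOnFinite.symm fun i => η (σ i) + ((σ i).rev : ℕ))
  rw [mul_one] at this
  rw [← this]
  simp

theorem kas_perm (n : ℕ) (η lam : Fin n → ℕ) (hη : Antitone η) (hlam : Antitone lam)
    (σ : Equiv.Perm (Fin n))
    (h : ∀ i, η (σ i) + ((σ i).rev : ℕ) = lam i + (i.rev : ℕ)) : σ = 1 ∧ η = lam := by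
  have hs : StrictMono σ := by
    intro a b hab
    by_contra hc
    have h1 := hη (not_lt.1 hc)
    have h2 := hlam hab.le
    have ha := h a
    have hb := h b
    simp only [Fin.val_rev] at ha hb
    rw [Fin.lt_def] at hab
    rw [Fin.lt_def] at hc
    omega
  have : σ = 1 := by
    ext i
    have := Subsingleton.elim (hs.orderIsoOfSurjective σ σ.surjective) (OrderIso.refl _)
    have := DFunLike.congr_fun this i
    simpa using congrArg Fin.val this
  subst this
  refine ⟨rfl, funext fun i => ?_⟩
  simpa using h i

/-- Alternating-sum inversion for Kostka numbers: for partitions `η, λ` with at most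
`n` parts and `|η| = |λ|`,
`∑_{τ ∈ S_n} ε(τ) K_{η,(λ_1+τ(1)-1,…,λ_n+τ(n)-n)} = δ_{η,λ}`. -/
theorem kostka_alternating_sum (n : ℕ) (η lam : Fin n → ℕ)
    (hη : ∀ i j : Fin n, i ≤ j → η j ≤ η i) (hlam : ∀ i j : Fin n, i ≤ j → lam j ≤ lam i)
    (hw : ∑ i, η i = ∑ i, lam i) :
    ∑ τ : Equiv.Perm (Fin n),
        ((Equiv.Perm.sign τ : ℤˣ) : ℤ) *
          (kostkaZ n (shapeOf n η) (fun i => (lam i : ℤ) + ((τ i : ℕ) : ℤ) - (i : ℕ)) : ℤ)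
      = if η = lam then 1 else 0 := by
  classical
  have hη' : Antitone η := fun i j h => hη i j h
  have hlam' : Antitone lam := fun i j h => hlam i j h
  have key := congrArg (MvPolynomial.coeff (Finsupp.equivFunOnFinite.symm fun i => lam i + (i.rev : ℕ)))
    (kas_main n (MvPolynomial.X : Fin n → MvPolynomial (Fin n) ℤ) η hη')
  rw [kas_D_X, kas_D_X, Finset.sum_mul, MvPolynomial.coeff_sum, MvPolynomial.coeff_sum] at key
  refine Eq.trans ?_ (key.trans ?_)
  · refine Finset.sum_congr rfl fun σ _ => ?_
    rw [MvPolynomial.coeff_monomial_mul', kas_kostka n η hη']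
    have hiff : (Finsupp.equivFunOnFinite.symm (fun i => (0 : Fin n → ℕ) (σ i) + ((σ i).rev : ℕ)) ≤
        Finsupp.equivFunOnFinite.symm fun i => lam i + (i.rev : ℕ)) ↔
        ∀ i, 0 ≤ (lam i : ℤ) + ((σ i : ℕ) : ℤ) - (i : ℕ) := by
      rw [Finsupp.le_def]
      refine forall_congr' fun i => ?_
      simp only [Finsupp.equivFunOnFinite_symm_apply_apply, Pi.zero_apply, Fin.val_rev]
      have := (σ i).2
      have := i.2
      omega
    unfold kostkaZ
    by_cases hc : ∀ i, 0 ≤ (lam i : ℤ) + ((σ i : ℕ) : ℤ) - (i : ℕ)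
    · rw [if_pos hc, if_pos (hiff.2 hc)]
      congr 3
      funext i
      simp only [Finsupp.tsub_apply, Finsupp.equivFunOnFinite_symm_apply_apply, Pi.zero_apply, Fin.val_rev]
      have := (σ i).2
      have := i.2
      have := hc i
      omega
    · rw [if_neg hc, if_neg (fun h => hc (hiff.1 h))]
      simp
  · simp only [MvPolynomial.coeff_monomial, Finsupp.ext_iff, Finsupp.equivFunOnFinite_symm_apply_apply]
    split_ifs with h
    · subst h
      rw [Finset.sum_eq_single 1]
      · simp
      · intro σ _ hσ
        rw [if_neg]
        exact fun h => hσ (kas_perm n η η hη' hη' σ h).1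
      · simp
    · refine Finset.sum_eq_zero fun σ _ => ?_
      rw [if_neg]
      exact fun h' => h (kas_perm n η lam hη' hlam' σ h').2
end

section
/- For sequences μ = (μ_1,...,μ_L) of rectangular partitions: the isomorphism σ between two successive rectangular factors is well-defined; i.e., for p ∈ B_α, p' ∈ B_{α'} with α, α' rectangles, there exist unique tableaux p̃' ∈ B_{α'} and p̃ ∈ B_α with p·p' = p̃'·p̃. -/
/-- An elementary Knuth transformation on words. -/
inductive KnuthStep : List ℕ → List ℕ → Prop
  | k1 (u v : List ℕ) (x y z : ℕ) (h1 : x ≤ y) (h2 : y < z) :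
      KnuthStep (u ++ z :: x :: y :: v) (u ++ x :: z :: y :: v)
  | k2 (u v : List ℕ) (x y z : ℕ) (h1 : x < y) (h2 : y ≤ z) :
      KnuthStep (u ++ y :: x :: z :: v) (u ++ y :: z :: x :: v)

/-- Knuth (plactic) equivalence of words. -/
def KnuthEquiv : List ℕ → List ℕ → Prop := Relation.EqvGen KnuthStep

/-- `T : ℕ → ℕ → ℕ` is a semistandard Young tableau of rectangular shape `(w^h)`
over the alphabet `{1,…,n}`, supported on the rectangle. -/
def IsRectTab (n w h : ℕ) (T : ℕ → ℕ → ℕ) : Prop :=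
  (∀ r c, ¬ (r < h ∧ c < w) → T r c = 0) ∧
  (∀ r c, r < h → c < w → 1 ≤ T r c ∧ T r c ≤ n) ∧
  (∀ r c, r < h → c + 1 < w → T r c ≤ T r (c + 1)) ∧
  (∀ r c, r + 1 < h → c < w → T r c < T (r + 1) c)

/-- The row word of a rectangular tableau (top row first). -/
def rWord (w h : ℕ) (T : ℕ → ℕ → ℕ) : List ℕ :=
  (((List.range h).reverse).map (fun r => (List.range w).map (T r))).flatten

set_option linter.unreachableTactic false
set_option linter.unusedTactic false
set_option linter.unusedVariables false

namespace SigmaAux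

def ph (i : ℕ) : List ℕ → ℕ
  | [] => 0
  | a :: v => if a = i then ph i v + 1 else if a = i + 1 then ph i v - 1 else ph i v

def ee (i : ℕ) : List ℕ → Option (List ℕ)
  | [] => none
  | a :: v => if a = i + 1 ∧ ph i v = 0 then some (i :: v) else (ee i v).map (fun t => a :: t)

def ff (i : ℕ) : List ℕ → Option (List ℕ)
  | [] => none
  | a :: v => if ph i (a :: v) = 0 then none else
      if ph i v = 0 then some ((i + 1) :: v) else (ff i v).map (fun t => a :: t)

/-- Knuth equivalence on optional words. -/
def OKE : Option (List ℕ) → Option (List ℕ) → Prop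
  | none, none => True
  | some a, some b => KnuthEquiv a b
  | _, _ => False

theorem ke_refl (a : List ℕ) : KnuthEquiv a a := Relation.EqvGen.refl a
theorem ke_symm {a b : List ℕ} (h : KnuthEquiv a b) : KnuthEquiv b a := Relation.EqvGen.symm _ _ h
theorem ke_trans {a b c : List ℕ} (h : KnuthEquiv a b) (h' : KnuthEquiv b c) : KnuthEquiv a c :=
  Relation.EqvGen.trans _ _ _ h h'
theorem ke_step {a b : List ℕ} (h : KnuthStep a b) : KnuthEquiv a b := Relation.EqvGen.rel _ _ h

theorem step_ctx {a b : List ℕ} (s t : List ℕ) (h : KnuthStep a b) :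
    KnuthStep (s ++ a ++ t) (s ++ b ++ t) := by
  cases h with
  | k1 u v x y z h1 h2 => simpa using KnuthStep.k1 (s ++ u) (v ++ t) x y z h1 h2
  | k2 u v x y z h1 h2 => simpa using KnuthStep.k2 (s ++ u) (v ++ t) x y z h1 h2

theorem ke_ctx {a b : List ℕ} (s t : List ℕ) (h : KnuthEquiv a b) :
    KnuthEquiv (s ++ a ++ t) (s ++ b ++ t) := by
  induction h with
  | rel _ _ h => exact ke_step (step_ctx s t h)
  | refl _ => exact ke_refl _
  | symm _ _ _ ih => exact ke_symm ih
  | trans _ _ _ _ _ i1 i2 => exact ke_trans i1 i2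

theorem ke_cons {a b : List ℕ} (c : ℕ) (h : KnuthEquiv a b) : KnuthEquiv (c :: a) (c :: b) := by
  simpa using ke_ctx [c] [] h

theorem ke_append {a b c d : List ℕ} (h : KnuthEquiv a b) (h' : KnuthEquiv c d) :
    KnuthEquiv (a ++ c) (b ++ d) := by
  have h1 := ke_ctx [] c h
  have h2 := ke_ctx b [] h'
  simp at h1 h2
  exact ke_trans h1 h2

theorem ke_perm {a b : List ℕ} (h : KnuthEquiv a b) : a.Perm b := by
  induction h with
  | rel _ _ h =>
    cases h with
    | k1 u v x y z h1 h2 => exact List.Perm.append_left _ (List.Perm.swap _ _ _)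
    | k2 u v x y z h1 h2 =>
      exact List.Perm.append_left _ (List.Perm.cons _ (List.Perm.swap _ _ _))
  | refl _ => exact List.Perm.refl _
  | symm _ _ _ ih => exact ih.symm
  | trans _ _ _ _ _ i1 i2 => exact i1.trans i2

theorem oke_refl (a : Option (List ℕ)) : OKE a a := by
  cases a <;> simp [OKE, ke_refl]
theorem oke_symm {a b : Option (List ℕ)} (h : OKE a b) : OKE b a := by
  cases a <;> cases b <;> simp_all [OKE]
  exact ke_symm h
theorem oke_trans {a b c : Option (List ℕ)} (h : OKE a b) (h' : OKE b c) : OKE a c := by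
  cases a <;> cases b <;> cases c <;> simp_all [OKE]
  exact ke_trans h h'
theorem oke_map {a b : Option (List ℕ)} (c : ℕ) (h : OKE a b) :
    OKE (a.map (fun t => c :: t)) (b.map (fun t => c :: t)) := by
  cases a <;> cases b <;> simp_all [OKE]
  exact ke_cons c h

theorem k1' (v : List ℕ) (x y z : ℕ) (h1 : x ≤ y) (h2 : y < z) :
    KnuthEquiv (z :: x :: y :: v) (x :: z :: y :: v) :=
  ke_step (by simpa using KnuthStep.k1 [] v x y z h1 h2)
theorem k2' (v : List ℕ) (x y z : ℕ) (h1 : x < y) (h2 : y ≤ z) :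
    KnuthEquiv (y :: x :: z :: v) (y :: z :: x :: v) :=
  ke_step (by simpa using KnuthStep.k2 [] v x y z h1 h2)

theorem ph_k1 (i : ℕ) (v : List ℕ) (x y z : ℕ) (h1 : x ≤ y) (h2 : y < z) :
    ph i (z :: x :: y :: v) = ph i (x :: z :: y :: v) := by
  simp only [ph]
  split_ifs <;> omega
theorem ph_k2 (i : ℕ) (v : List ℕ) (x y z : ℕ) (h1 : x < y) (h2 : y ≤ z) :
    ph i (y :: x :: z :: v) = ph i (y :: z :: x :: v) := by
  simp only [ph]
  split_ifs <;> omega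

theorem ph_congr (i : ℕ) (u a b : List ℕ) (h : ph i a = ph i b) : ph i (u ++ a) = ph i (u ++ b) := by
  induction u with
  | nil => simpa
  | cons c u ih => simp [ph, ih]

theorem ee_congr (i : ℕ) (u a b : List ℕ) (h : ph i a = ph i b) (hk : KnuthEquiv a b)
    (he : OKE (ee i a) (ee i b)) : OKE (ee i (u ++ a)) (ee i (u ++ b)) := by
  induction u with
  | nil => simpa
  | cons c u ih =>
    have := ph_congr i u a b h
    simp only [List.cons_append, ee, this]
    split_ifs
    · have := ke_ctx (i :: u) [] hk
      simpa [OKE] using this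
    · exact oke_map _ ih

theorem ff_congr (i : ℕ) (u a b : List ℕ) (h : ph i a = ph i b) (hk : KnuthEquiv a b)
    (he : OKE (ff i a) (ff i b)) : OKE (ff i (u ++ a)) (ff i (u ++ b)) := by
  induction u with
  | nil => simpa
  | cons c u ih =>
    have := ph_congr i u a b h
    have h2 := ph_congr i (c :: u) a b h
    simp only [List.cons_append, ff, this] at h2 ⊢
    rw [h2]
    split_ifs
    · trivial
    · have := ke_ctx ((i+1) :: u) [] hk
      simpa [OKE] using this
    · exact oke_map _ ih

theorem tri (i x : ℕ) : x = i ∨ x = i + 1 ∨ (x ≠ i ∧ x ≠ i + 1) := by omega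

theorem ee_k1 (i : ℕ) (v : List ℕ) (x y z : ℕ) (h1 : x ≤ y) (h2 : y < z) :
    OKE (ee i (z :: x :: y :: v)) (ee i (x :: z :: y :: v)) := by
  rcases tri i x with hx | hx | ⟨hx, hx'⟩ <;> rcases tri i y with hy | hy | ⟨hy, hy'⟩ <;>
    rcases tri i z with hz | hz | ⟨hz, hz'⟩ <;> (try omega) <;>
    rcases Nat.eq_zero_or_pos (ph i v) with hp | hp <;>
    rcases hv : ee i v with _ | v' <;>
    (try subst hx) <;> (try subst hy) <;> (try subst hz) <;>
    simp [ee, ph, OKE, *] <;>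
    first
      | omega
      | (apply k1' <;> omega)
      | (apply k2' <;> omega)
      | (apply ke_symm; apply k1' <;> omega)
      | (apply ke_symm; apply k2' <;> omega)
      | (split_ifs <;> first
          | omega
          | trivial
          | (apply k1' <;> omega)
          | (apply k2' <;> omega)
          | (apply ke_symm; apply k1' <;> omega)
          | (apply ke_symm; apply k2' <;> omega))

theorem ee_k2 (i : ℕ) (v : List ℕ) (x y z : ℕ) (h1 : x < y) (h2 : y ≤ z) :
    OKE (ee i (y :: x :: z :: v)) (ee i (y :: z :: x :: v)) := by
  rcases tri i x with hx | hx | ⟨hx, hx'⟩ <;> rcases tri i y with hy | hy | ⟨hy, hy'⟩ <;>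
    rcases tri i z with hz | hz | ⟨hz, hz'⟩ <;> (try omega) <;>
    rcases Nat.eq_zero_or_pos (ph i v) with hp | hp <;>
    rcases hv : ee i v with _ | v' <;>
    (try subst hx) <;> (try subst hy) <;> (try subst hz) <;>
    simp [ee, ph, OKE, *] <;>
    first
      | omega
      | (apply k1' <;> omega)
      | (apply k2' <;> omega)
      | (apply ke_symm; apply k1' <;> omega)
      | (apply ke_symm; apply k2' <;> omega)
      | (split_ifs <;> first
          | omega
          | trivial
          | (apply k1' <;> omega)
          | (apply k2' <;> omega)
          | (apply ke_symm; apply k1' <;> omega)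
          | (apply ke_symm; apply k2' <;> omega))

theorem ff_k1 (i : ℕ) (v : List ℕ) (x y z : ℕ) (h1 : x ≤ y) (h2 : y < z) :
    OKE (ff i (z :: x :: y :: v)) (ff i (x :: z :: y :: v)) := by
  rcases tri i x with hx | hx | ⟨hx, hx'⟩ <;> rcases tri i y with hy | hy | ⟨hy, hy'⟩ <;>
    rcases tri i z with hz | hz | ⟨hz, hz'⟩ <;> (try omega) <;>
    rcases Nat.eq_zero_or_pos (ph i v) with hp | hp <;>
    rcases hv : ff i v with _ | v' <;>
    (try subst hx) <;> (try subst hy) <;> (try subst hz) <;>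
    simp [ff, ph, OKE, *] <;>
    first
      | omega
      | (apply k1' <;> omega)
      | (apply k2' <;> omega)
      | (apply ke_symm; apply k1' <;> omega)
      | (apply ke_symm; apply k2' <;> omega)
      | (split_ifs <;> first
          | omega
          | trivial
          | (apply k1' <;> omega)
          | (apply k2' <;> omega)
          | (apply ke_symm; apply k1' <;> omega)
          | (apply ke_symm; apply k2' <;> omega))

theorem ff_k2 (i : ℕ) (v : List ℕ) (x y z : ℕ) (h1 : x < y) (h2 : y ≤ z) :
    OKE (ff i (y :: x :: z :: v)) (ff i (y :: z :: x :: v)) := by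
  rcases tri i x with hx | hx | ⟨hx, hx'⟩ <;> rcases tri i y with hy | hy | ⟨hy, hy'⟩ <;>
    rcases tri i z with hz | hz | ⟨hz, hz'⟩ <;> (try omega) <;>
    rcases Nat.eq_zero_or_pos (ph i v) with hp | hp <;>
    rcases hv : ff i v with _ | v' <;>
    (try subst hx) <;> (try subst hy) <;> (try subst hz) <;>
    simp [ff, ph, OKE, *] <;>
    first
      | omega
      | (apply k1' <;> omega)
      | (apply k2' <;> omega)
      | (apply ke_symm; apply k1' <;> omega)
      | (apply ke_symm; apply k2' <;> omega)
      | (split_ifs <;> first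
          | omega
          | trivial
          | (apply k1' <;> omega)
          | (apply k2' <;> omega)
          | (apply ke_symm; apply k1' <;> omega)
          | (apply ke_symm; apply k2' <;> omega))

theorem ee_ke (i : ℕ) {a b : List ℕ} (h : KnuthEquiv a b) : OKE (ee i a) (ee i b) := by
  induction h with
  | rel _ _ h =>
    cases h with
    | k1 u v x y z h1 h2 =>
      exact ee_congr _ _ _ _ (ph_k1 _ _ _ _ _ h1 h2) (k1' _ _ _ _ h1 h2) (ee_k1 _ _ _ _ _ h1 h2)
    | k2 u v x y z h1 h2 =>
      exact ee_congr _ _ _ _ (ph_k2 _ _ _ _ _ h1 h2) (k2' _ _ _ _ h1 h2) (ee_k2 _ _ _ _ _ h1 h2)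
  | refl _ => exact oke_refl _
  | symm _ _ _ ih => exact oke_symm ih
  | trans _ _ _ _ _ i1 i2 => exact oke_trans i1 i2

theorem ff_ke (i : ℕ) {a b : List ℕ} (h : KnuthEquiv a b) : OKE (ff i a) (ff i b) := by
  induction h with
  | rel _ _ h =>
    cases h with
    | k1 u v x y z h1 h2 =>
      exact ff_congr _ _ _ _ (ph_k1 _ _ _ _ _ h1 h2) (k1' _ _ _ _ h1 h2) (ff_k1 _ _ _ _ _ h1 h2)
    | k2 u v x y z h1 h2 =>
      exact ff_congr _ _ _ _ (ph_k2 _ _ _ _ _ h1 h2) (k2' _ _ _ _ h1 h2) (ff_k2 _ _ _ _ _ h1 h2)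
  | refl _ => exact oke_refl _
  | symm _ _ _ ih => exact oke_symm ih
  | trans _ _ _ _ _ i1 i2 => exact oke_trans i1 i2

theorem ee_ff (i : ℕ) (w w' : List ℕ) (h : ee i w = some w') :
    ff i w' = some w ∧ ph i w' = ph i w + 1 := by
  induction w generalizing w' with
  | nil => simp [ee] at h
  | cons a v ih =>
    simp only [ee] at h
    split_ifs at h with hc
    · obtain ⟨h1, h2⟩ := hc
      simp at h
      subst h
      simp [ff, ph, h1, h2]
    · rcases hv : ee i v with _ | v'
      · simp [hv] at h
      · simp [hv] at h
        subst h
        obtain ⟨h1, h2⟩ := ih v' hv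
        have h3 : ph i (a :: v') = ph i (a :: v) + 1 := by
          simp only [ph]; split_ifs <;> omega
        refine ⟨?_, h3⟩
        simp [ff, h1, h2, h3]

theorem ff_ee (i : ℕ) (w w' : List ℕ) (h : ff i w = some w') :
    ee i w' = some w ∧ ph i w = ph i w' + 1 := by
  induction w generalizing w' with
  | nil => simp [ff] at h
  | cons a v ih =>
    simp only [ff] at h
    split_ifs at h with hc hd
    · simp at h
      subst h
      have : a = i := by
        by_contra hh
        simp only [ph] at hc
        split_ifs at hc <;> omega
      simp [ee, ph, hd, this]
    · rcases hv : ff i v with _ | v'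
      · simp [hv] at h
      · simp [hv] at h
        subst h
        obtain ⟨h1, h2⟩ := ih v' hv
        have h4 : ¬ (a = i + 1 ∧ ph i v' = 0) := by
          rintro ⟨rfl, h0⟩
          apply hc
          simp only [ph]; split_ifs <;> omega
        have h3 : ph i (a :: v) = ph i (a :: v') + 1 := by
          simp only [ph]; split_ifs <;> omega
        refine ⟨?_, h3⟩
        simp only [ee, if_neg h4, h1, Option.map_some]

theorem ph_prefix (i : ℕ) (s t : List ℕ) : s.count i ≤ s.count (i+1) + ph i (s ++ t) := by
  induction s with
  | nil => simp
  | cons a s ih =>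
    simp only [List.count_cons, List.cons_append, ph, beq_iff_eq]
    split_ifs <;> omega

theorem ee_decomp (i : ℕ) (w w' : List ℕ) (h : ee i w = some w') :
    ∃ u v, w = u ++ (i+1) :: v ∧ w' = u ++ i :: v ∧ ph i v = 0 ∧
      (ph i w + u.count (i+1) = u.count i) ∧
      ∀ s, s <:+ u → s.count (i+1) ≤ s.count i := by
  induction w generalizing w' with
  | nil => simp [ee] at h
  | cons a v ih =>
    simp only [ee] at h
    split_ifs at h with hc
    · obtain ⟨h1, h2⟩ := hc
      simp at h
      subst h
      refine ⟨[], v, by simp [h1], by simp, h2, by simp [ph, h1, h2], by simp⟩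
    · rcases hv : ee i v with _ | v'
      · simp [hv] at h
      · simp [hv] at h
        subst h
        obtain ⟨u, t, h1, h2, h3, h4, h5⟩ := ih v' hv
        have h6 : ph i (a :: v) + (a :: u).count (i+1) = (a :: u).count i := by
          simp only [List.count_cons, ph, beq_iff_eq]
          split_ifs <;> omega
        refine ⟨a :: u, t, by simp [h1], by simp [h2], h3, h6, ?_⟩
        intro s hs
        rcases List.suffix_cons_iff.1 hs with rfl | hs
        · omega
        · exact h5 s hs

theorem ee_none (i : ℕ) (w : List ℕ) (h : ee i w = none) :
    (ph i w + w.count (i+1) = w.count i) ∧ ∀ s, s <:+ w → s.count (i+1) ≤ s.count i := by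
  induction w with
  | nil => simp [ph]
  | cons a v ih =>
    simp only [ee] at h
    split_ifs at h with hc
    simp at h
    obtain ⟨h4, h5⟩ := ih h
    have h6 : ph i (a :: v) + (a :: v).count (i+1) = (a :: v).count i := by
      simp only [List.count_cons, ph, beq_iff_eq]
      split_ifs <;> omega
    refine ⟨h6, ?_⟩
    intro s hs
    rcases List.suffix_cons_iff.1 hs with rfl | hs
    · omega
    · exact h5 s hs

theorem none_ee (i : ℕ) (w : List ℕ) (h : ∀ s, s <:+ w → s.count (i+1) ≤ s.count i) :
    ee i w = none := by
  rcases hw : ee i w with _ | w'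
  · rfl
  · obtain ⟨u, v, h1, h2, h3, h4, h5⟩ := ee_decomp i w w' hw
    have := h ((i+1) :: v) (by rw [h1]; exact List.suffix_append _ _)
    have h7 := ph_prefix i v []
    simp [List.count_cons, h3] at this h7
    omega

/-- Highest weight (Yamanouchi) words. -/
def HW (w : List ℕ) : Prop := ∀ i, 1 ≤ i → ∀ s, s <:+ w → s.count (i+1) ≤ s.count i

theorem not_hw (w : List ℕ) (h : ¬ HW w) : ∃ i w', 1 ≤ i ∧ ee i w = some w' := by
  by_contra hc
  push Not at hc
  apply h
  intro i hi
  refine (ee_none i w ?_).2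
  rcases hw : ee i w with _ | w'
  · rfl
  · exact absurd hw (hc i w' hi)

theorem hw_ke {a b : List ℕ} (h : KnuthEquiv a b) (ha : HW a) : HW b := by
  intro i hi
  refine (ee_none i b ?_).2
  have h1 := ee_ke i h
  rw [none_ee i a (ha i hi)] at h1
  rcases hw : ee i b with _ | w'
  · rfl
  · simp [hw, OKE] at h1

/-- The column word `k, k-1, ..., 1`. -/
def col : ℕ → List ℕ
  | 0 => []
  | k + 1 => (k + 1) :: col k

theorem colA (a k : ℕ) (h : k + 1 ≤ a) :
    KnuthEquiv ((k + 1) :: a :: col k) ((k + 1) :: (col k ++ [a])) := by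
  induction k with
  | zero => exact ke_refl _
  | succ k ih =>
    simp only [col]
    refine ke_trans (ke_symm (k2' (col k) (k+1) (k+1+1) a (by omega) h)) ?_
    exact ke_cons _ (ih (by omega))

theorem colB (a l : ℕ) (h1 : 1 ≤ a) (h : a ≤ l) : KnuthEquiv (a :: col l) (col l ++ [a]) := by
  induction l with
  | zero => omega
  | succ k ih =>
    rcases Nat.eq_or_lt_of_le h with h2 | h2
    · subst h2
      exact colA (k+1) k le_rfl
    · have h3 := ke_cons (k+1) (ih (by omega))
      refine ke_trans ?_ h3
      obtain ⟨j, rfl⟩ : ∃ j, k = j + 1 := ⟨k - 1, by omega⟩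
      exact ke_symm (k1' (col j) a (j+1) (j+1+1) (by omega) (by omega))

theorem colC (k l : ℕ) (h : k ≤ l) : KnuthEquiv (col k ++ col l) (col l ++ col k) := by
  induction k with
  | zero => simpa [col] using ke_refl _
  | succ k ih =>
    have h1 := ke_cons (k+1) (ih (by omega))
    have h2 := ke_ctx [] (col k) (colB (k+1) l (by omega) h)
    simp [col] at h1 h2 ⊢
    exact ke_trans h1 h2

theorem colD (k l : ℕ) : KnuthEquiv (col k ++ col l) (col l ++ col k) := by
  rcases le_total k l with h | h
  · exact colC k l h
  · exact ke_symm (colC l k h)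

def cw (ls : List ℕ) : List ℕ := ls.flatMap col

theorem cw_perm {a b : List ℕ} (h : a.Perm b) : KnuthEquiv (cw a) (cw b) := by
  induction h with
  | nil => exact ke_refl _
  | cons x _ ih => exact ke_append (ke_refl (col x)) ih
  | swap x y l =>
    have := ke_append (colD y x) (ke_refl (cw l))
    simpa [cw] using this
  | trans _ _ i1 i2 => exact ke_trans i1 i2

theorem count_col (a l : ℕ) (h : 1 ≤ a) : (col l).count a = if a ≤ l then 1 else 0 := by
  induction l with
  | zero => simp [col]; omega
  | succ l ih =>
    simp only [col, List.count_cons, ih, beq_iff_eq]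
    split_ifs <;> omega

theorem count_cw (a : ℕ) (h : 1 ≤ a) (ls : List ℕ) : (cw ls).count a = ls.countP (fun l => a ≤ l) := by
  induction ls with
  | nil => simp [cw]
  | cons l ls ih =>
    have : cw (l :: ls) = col l ++ cw ls := rfl
    rw [this, List.count_append, ih, count_col a l h, List.countP_cons]
    simp [add_comm]

theorem countP_split (a : ℕ) (ls : List ℕ) :
    ls.countP (fun l => a ≤ l) = ls.countP (fun l => a + 1 ≤ l) + ls.count a := by
  induction ls with
  | nil => simp
  | cons l ls ih =>
    simp only [List.countP_cons, List.count_cons, ih, decide_eq_true_eq, beq_iff_eq]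
    split_ifs <;> omega

theorem hw_canon (w : List ℕ) (hw : HW w) (hpos : ∀ a ∈ w, 1 ≤ a) :
    ∃ ls : List ℕ, (∀ l ∈ ls, 1 ≤ l) ∧ KnuthEquiv w (cw ls) := by
  induction w with
  | nil => exact ⟨[], by simp, ke_refl _⟩
  | cons a v ih =>
    obtain ⟨ls, h1, h2⟩ := ih (fun i hi s hs => hw i hi s (hs.trans (List.suffix_cons a v)))
      (fun b hb => hpos b (List.mem_cons_of_mem _ hb))
    have ha : 1 ≤ a := hpos a List.mem_cons_self
    obtain ⟨b, rfl⟩ : ∃ b, a = b + 1 := ⟨a - 1, by omega⟩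
    rcases Nat.eq_zero_or_pos b with rfl | hb
    · refine ⟨1 :: ls, by simpa using h1, ?_⟩
      exact ke_cons 1 h2
    · have h3 := hw b hb _ List.suffix_rfl
      have p := ke_perm h2
      simp only [List.count_cons_self] at h3
      rw [List.count_cons_of_ne (by omega), p.count_eq, p.count_eq, count_cw _ ha, count_cw _ hb,
        countP_split b] at h3
      have h4 : b ∈ ls := List.count_pos_iff.1 (by omega)
      have h5 := List.perm_cons_erase h4
      refine ⟨(b + 1) :: ls.erase b, ?_, ?_⟩
      · intro l hl
        rcases List.mem_cons.1 hl with rfl | hl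
        · omega
        · exact h1 l (List.mem_of_mem_erase hl)
      · exact ke_cons _ (ke_trans h2 (cw_perm h5))

theorem hw_ke_of_perm (w w' : List ℕ) (hw : HW w) (hw' : HW w') (hpos : ∀ a ∈ w, 1 ≤ a)
    (hp : w.Perm w') : KnuthEquiv w w' := by
  obtain ⟨l1, a1, b1⟩ := hw_canon w hw hpos
  obtain ⟨l2, a2, b2⟩ := hw_canon w' hw' (fun a ha => hpos a (hp.mem_iff.2 ha))
  have hq : (cw l1).Perm (cw l2) := ((ke_perm b1).symm.trans hp).trans (ke_perm b2)
  have hl : l1.Perm l2 := by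
    rw [List.perm_iff_count]
    intro a
    rcases Nat.eq_zero_or_pos a with rfl | ha
    · rw [List.count_eq_zero.2, List.count_eq_zero.2]
      · intro h; have := a2 _ h; omega
      · intro h; have := a1 _ h; omega
    · have e1 := hq.count_eq a
      have e2 := hq.count_eq (a+1)
      rw [count_cw _ (by omega), count_cw _ (by omega)] at e1 e2
      have s1 := countP_split a l1
      have s2 := countP_split a l2
      omega
  exact ke_trans b1 (ke_trans (cw_perm hl) (ke_symm b2))

/-- Word of the rows `R 0, ..., R (h-1)`, last row first. -/
def wd : ℕ → (ℕ → List ℕ) → List ℕ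
  | 0, _ => []
  | h + 1, R => R h ++ wd h R

structure TabF (w h : ℕ) (R : ℕ → List ℕ) : Prop where
  len : ∀ r < h, (R r).length = w
  srt : ∀ r < h, (R r).Pairwise (· ≤ ·)
  pos : ∀ r < h, ∀ a ∈ R r, 1 ≤ a
  dom : ∀ r, r + 1 < h → ∀ v, (R (r+1)).countP (· ≤ v + 1) ≤ (R r).countP (· ≤ v)

theorem wd_congr (h : ℕ) (R S : ℕ → List ℕ) (hRS : ∀ r < h, R r = S r) : wd h R = wd h S := by
  induction h with
  | zero => rfl
  | succ h ih =>
    simp only [wd]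
    rw [hRS h (by omega), ih (fun r hr => hRS r (by omega))]

theorem wd_split (h : ℕ) (R : ℕ → List ℕ) (u v : List ℕ) (a : ℕ) (e : wd h R = u ++ a :: v) :
    ∃ r R1 R2 U, r < h ∧ R r = R1 ++ a :: R2 ∧ u = U ++ R1 ∧ v = R2 ++ wd r R ∧
      (r + 1 < h → ∃ U', U = U' ++ R (r+1)) ∧
      ∀ b, u ++ b :: v = wd h (Function.update R r (R1 ++ b :: R2)) := by
  induction h generalizing u v with
  | zero => simp [wd] at e
  | succ h ih =>
    simp only [wd] at e
    rcases List.append_eq_append_iff.1 e with ⟨c, h1, h2⟩ | ⟨c, h1, h2⟩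
    · obtain ⟨r, R1, R2, U, g1, g2, g3, g4, g5, g6⟩ := ih c v h2
      refine ⟨r, R1, R2, R h ++ U, by omega, g2, by simp [h1, g3], g4, ?_, ?_⟩
      · intro hr
        by_cases hh : r + 1 < h
        · obtain ⟨U', hU⟩ := g5 hh
          exact ⟨R h ++ U', by simp [hU]⟩
        · have : r + 1 = h := by omega
          subst this
          have g7 := g6 a
          have : U = [] := by
            have e3 : wd (r+1) R = U ++ R1 ++ a :: v := by rw [h2, g3]
            simp only [wd, g2, g4] at e3
            have := congrArg List.length e3
            simp only [List.length_append, List.length_cons] at this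
            exact List.length_eq_zero_iff.1 (by omega)
          exact ⟨[], by simp [this]⟩
      · intro b
        simp only [wd]
        rw [Function.update_of_ne (by omega), h1, List.append_assoc, g6 b]
    · rcases c with _ | ⟨a', c⟩
      · simp at h1 h2
        obtain ⟨r, R1, R2, U, g1, g2, g3, g4, g5, g6⟩ := ih [] v (by simpa using h2.symm)
        simp at g3
        obtain ⟨rfl, rfl⟩ := g3
        refine ⟨r, [], R2, u, by omega, g2, by simp, g4, ?_, ?_⟩
        · intro hr
          by_cases hh : r + 1 < h
          · obtain ⟨U', hU⟩ := g5 hh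
            have : R (r+1) = [] := by simp at hU; exact hU.2
            exact ⟨u, by simp [this]⟩
          · have : r + 1 = h := by omega
            subst this
            exact ⟨[], by simp [h1]⟩
        · intro b
          simp only [wd]
          rw [Function.update_of_ne (by omega), h1, ← g6 b]
          simp
      · simp at h2
        obtain ⟨rfl, h2⟩ := h2
        refine ⟨h, u, c, [], by omega, h1, by simp, h2, by intro hh; omega, ?_⟩
        intro b
        simp only [wd, Function.update_self]
        rw [wd_congr h _ R (fun r hr => Function.update_of_ne (by omega) _ _), h2]
        simp

theorem countP_le_succ (v : ℕ) (L : List ℕ) :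
    L.countP (· ≤ v + 1) = L.countP (· ≤ v) + L.count (v + 1) := by
  induction L with
  | nil => simp
  | cons l ls ih =>
    simp only [List.countP_cons, List.count_cons, ih, decide_eq_true_eq, beq_iff_eq]
    split_ifs <;> omega

theorem tab_ee (w h i : ℕ) (hi : 1 ≤ i) (R : ℕ → List ℕ) (hR : TabF w h R) (u v : List ℕ)
    (e : wd h R = u ++ (i+1) :: v) (hv : ph i v = 0)
    (hu : ∀ s, s <:+ u → s.count (i+1) ≤ s.count i) :
    ∃ R', TabF w h R' ∧ u ++ i :: v = wd h R' := by
  obtain ⟨r, R1, R2, U, g1, g2, g3, g4, g5, g6⟩ := wd_split h R u v (i+1) e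
  refine ⟨_, ?_, g6 i⟩
  have hs := hR.srt r g1
  rw [g2, List.pairwise_append] at hs
  obtain ⟨s1, s2, s3⟩ := hs
  rw [List.pairwise_cons] at s2
  have hle : ∀ a ∈ R1, a ≤ i := by
    intro a ha
    by_contra hc
    have h1 := s3 a ha (i+1) List.mem_cons_self
    have : a = i + 1 := by omega
    subst this
    obtain ⟨t1, t2, rfl⟩ := List.append_of_mem ha
    have h2 := hu ((i+1) :: t2) ⟨U ++ t1, by rw [g3]; simp⟩
    have h3 : ((i+1) :: t2).count i = 0 := by
      rw [List.count_eq_zero]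
      intro hm
      rw [List.pairwise_append, List.pairwise_cons] at s1
      rcases List.mem_cons.1 hm with h | h
      · omega
      · have := s1.2.1.1 i h; omega
    simp at h2 h3
    omega
  have hcnt : ∀ x, (R1 ++ (i+1) :: R2).countP (· ≤ x) ≤ (R1 ++ i :: R2).countP (· ≤ x) := by
    intro x
    simp only [List.countP_append, List.countP_cons, decide_eq_true_eq]
    split_ifs <;> omega
  constructor
  · intro r' hr'
    by_cases hh : r' = r
    · subst hh
      have := hR.len r' hr'
      rw [g2] at this
      simpa using this
    · rw [Function.update_of_ne hh]; exact hR.len r' hr'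
  · intro r' hr'
    by_cases hh : r' = r
    · subst hh
      rw [Function.update_self, List.pairwise_append, List.pairwise_cons]
      refine ⟨s1, ⟨fun a ha => by have := s2.1 a ha; omega, s2.2⟩, ?_⟩
      intro a ha b hb
      rcases List.mem_cons.1 hb with rfl | hb
      · exact hle a ha
      · exact s3 a ha b (List.mem_cons_of_mem _ hb)
    · rw [Function.update_of_ne hh]; exact hR.srt r' hr'
  · intro r' hr'
    by_cases hh : r' = r
    · subst hh
      have := hR.pos r' hr'
      rw [g2] at this
      rw [Function.update_self]
      intro a ha
      simp only [List.mem_append, List.mem_cons] at ha this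
      rcases ha with ha | ha | ha
      · exact this a (Or.inl ha)
      · omega
      · exact this a (Or.inr (Or.inr ha))
    · rw [Function.update_of_ne hh]; exact hR.pos r' hr'
  · intro r' hr' x
    have hd := hR.dom r' hr' 
    by_cases h1 : r' = r
    · subst h1
      rw [Function.update_self, Function.update_of_ne (by omega)]
      have := hcnt x
      rw [← g2] at this
      exact (hd x).trans this
    · by_cases h2 : r' + 1 = r
      · subst h2
        rw [Function.update_self, Function.update_of_ne (by omega)]
        have hdx := hd x
        have hpx := ph_prefix i (R2 ++ R r') (wd r' R)
        have : R2 ++ R r' ++ wd r' R = v := by rw [g4]; simp [wd]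
        rw [this, hv] at hpx
        have k1 : R2.count i = 0 := by
          rw [List.count_eq_zero]
          intro hm; have := s2.1 i hm; omega
        have k3 : R1.count (i+1) = 0 := by
          rw [List.count_eq_zero]
          intro hm; have := hle _ hm; omega
        have k4 : (R r').count i ≤ R2.count (i+1) := by
          have hsr := hR.srt r' (by omega)
          have hflt : ∃ A B, R r' = A ++ B ∧ (∀ a ∈ A, a ≤ i) ∧ (∀ b ∈ B, i < b) := by
            refine ⟨(R r').takeWhile (· ≤ i), (R r').dropWhile (· ≤ i),
              (List.takeWhile_append_dropWhile).symm, ?_, ?_⟩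
            · intro a ha
              simpa using List.mem_takeWhile_imp ha
            · intro b hb
              rcases hD : (R r').dropWhile (· ≤ i) with _ | ⟨d, D⟩
              · simp [hD] at hb
              · have hd1 : ¬ (d ≤ i) := by
                  have := List.head_dropWhile_not (fun x => decide (x ≤ i)) (l := R r') (by simp [hD])
                  simpa [hD] using this
                have hpw : ((R r').dropWhile (· ≤ i)).Pairwise (· ≤ ·) :=
                  hsr.sublist (List.dropWhile_sublist _)
                rw [hD] at hb hpw
                rw [List.pairwise_cons] at hpw
                rcases List.mem_cons.1 hb with rfl | hb
                · omega
                · have := hpw.1 b hb; omega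
          obtain ⟨A, B, hAB, hA, hB⟩ := hflt
          have hq := ph_prefix i (R2 ++ A) (B ++ wd r' R)
          have : R2 ++ A ++ (B ++ wd r' R) = v := by rw [g4]; simp [wd, hAB]
          rw [this, hv] at hq
          have c1 : A.count (i+1) = 0 := by
            rw [List.count_eq_zero]
            intro hm; have := hA _ hm; omega
          have c2 : B.count i = 0 := by
            rw [List.count_eq_zero]
            intro hm; have := hB _ hm; omega
          rw [hAB]
          simp only [List.count_append] at hq ⊢
          omega
        rw [g2] at hd
        by_cases hx : x + 1 = i
        · have hdi := hd i
          subst hx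
          rw [countP_le_succ (x+1), countP_le_succ x (R r')] at hdi
          have q1 : (R1 ++ (x+1) :: R2).countP (· ≤ x+1) = (R1 ++ (x+1+1) :: R2).countP (· ≤ x+1) + 1 := by
            simp only [List.countP_append, List.countP_cons, decide_eq_true_eq]
            split_ifs <;> omega
          have q2 : (R1 ++ (x+1+1) :: R2).count (x+1+1) = R2.count (x+1+1) + 1 := by
            simp [k3]
          omega
        · have : (R1 ++ i :: R2).countP (· ≤ x+1) = (R1 ++ (i+1) :: R2).countP (· ≤ x+1) := by
            simp only [List.countP_append, List.countP_cons, decide_eq_true_eq]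
            split_ifs <;> omega
          rw [this]
          exact hd x
      · rw [Function.update_of_ne (by omega), Function.update_of_ne (by omega)]
        exact hd x

theorem sorted_split (i : ℕ) (L : List ℕ) (hsr : L.Pairwise (· ≤ ·)) :
    ∃ A B, L = A ++ B ∧ (∀ a ∈ A, a ≤ i) ∧ (∀ b ∈ B, i < b) := by
  refine ⟨L.takeWhile (· ≤ i), L.dropWhile (· ≤ i),
    (List.takeWhile_append_dropWhile).symm, ?_, ?_⟩
  · intro a ha
    simpa using List.mem_takeWhile_imp ha
  · intro b hb
    rcases hD : L.dropWhile (· ≤ i) with _ | ⟨d, D⟩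
    · simp [hD] at hb
    · have hd1 : ¬ (d ≤ i) := by
        have := List.head_dropWhile_not (fun x => decide (x ≤ i)) (l := L) (by simp [hD])
        simpa [hD] using this
      have hpw : (L.dropWhile (· ≤ i)).Pairwise (· ≤ ·) :=
        hsr.sublist (List.dropWhile_sublist _)
      rw [hD] at hb hpw
      rw [List.pairwise_cons] at hpw
      rcases List.mem_cons.1 hb with rfl | hb
      · omega
      · have := hpw.1 b hb; omega

theorem tab_ff (w h i : ℕ) (hi : 1 ≤ i) (R : ℕ → List ℕ) (hR : TabF w h R) (u v : List ℕ)
    (e : wd h R = u ++ i :: v) (hv : ph i v = 0)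
    (hu : ∀ s, s <:+ u → s.count (i+1) ≤ s.count i) :
    ∃ R', TabF w h R' ∧ u ++ (i+1) :: v = wd h R' := by
  obtain ⟨r, R1, R2, U, g1, g2, g3, g4, g5, g6⟩ := wd_split h R u v i e
  refine ⟨_, ?_, g6 (i+1)⟩
  have hs := hR.srt r g1
  rw [g2, List.pairwise_append] at hs
  obtain ⟨s1, s2, s3⟩ := hs
  rw [List.pairwise_cons] at s2
  have hge : ∀ a ∈ R2, i + 1 ≤ a := by
    intro a ha
    by_contra hc
    have h1 := s2.1 a ha
    have : a = i := by omega
    subst this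
    obtain ⟨t1, t2, rfl⟩ := List.append_of_mem ha
    have h2 := ph_prefix a (t1 ++ [a]) (t2 ++ wd r R)
    have : t1 ++ [a] ++ (t2 ++ wd r R) = v := by rw [g4]; simp
    rw [this, hv] at h2
    have h3 : (t1 ++ [a]).count (a+1) = 0 := by
      rw [List.count_eq_zero]
      intro hm
      have s4 := s2.2
      rw [List.pairwise_append] at s4
      rcases List.mem_append.1 hm with h | h
      · have := s4.2.2 (a+1) h a List.mem_cons_self; omega
      · simp at h
    have h4 : 1 ≤ (t1 ++ [a]).count a := by simp
    omega
  have hcnt : ∀ x, (R1 ++ (i+1) :: R2).countP (· ≤ x) ≤ (R1 ++ i :: R2).countP (· ≤ x) := by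
    intro x
    simp only [List.countP_append, List.countP_cons, decide_eq_true_eq]
    split_ifs <;> omega
  constructor
  · intro r' hr'
    by_cases hh : r' = r
    · subst hh
      have := hR.len r' hr'
      rw [g2] at this
      simpa using this
    · rw [Function.update_of_ne hh]; exact hR.len r' hr'
  · intro r' hr'
    by_cases hh : r' = r
    · subst hh
      rw [Function.update_self, List.pairwise_append, List.pairwise_cons]
      refine ⟨s1, ⟨fun a ha => hge a ha, s2.2⟩, ?_⟩
      intro a ha b hb
      rcases List.mem_cons.1 hb with rfl | hb
      · have := s3 a ha i List.mem_cons_self; omega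
      · exact s3 a ha b (List.mem_cons_of_mem _ hb)
    · rw [Function.update_of_ne hh]; exact hR.srt r' hr'
  · intro r' hr'
    by_cases hh : r' = r
    · subst hh
      have := hR.pos r' hr'
      rw [g2] at this
      rw [Function.update_self]
      intro a ha
      simp only [List.mem_append, List.mem_cons] at ha this
      rcases ha with ha | ha | ha
      · exact this a (Or.inl ha)
      · omega
      · exact this a (Or.inr (Or.inr ha))
    · rw [Function.update_of_ne hh]; exact hR.pos r' hr'
  · intro r' hr' x
    have hd := hR.dom r' hr'
    by_cases h1 : r' = r
    · subst h1
      rw [Function.update_self, Function.update_of_ne (by omega)]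
      have k4 : (R (r'+1)).count (i+1) ≤ R1.count i := by
        obtain ⟨A, B, hAB, hA, hB⟩ := sorted_split i _ (hR.srt (r'+1) hr')
        obtain ⟨U', hU'⟩ := g5 hr'
        have hq := hu (B ++ R1) ⟨U' ++ A, by rw [g3, hU', hAB]; simp⟩
        have c1 : A.count (i+1) = 0 := by
          rw [List.count_eq_zero]
          intro hm; have := hA _ hm; omega
        have c2 : B.count i = 0 := by
          rw [List.count_eq_zero]
          intro hm; have := hB _ hm; omega
        rw [hAB]
        simp only [List.count_append] at hq ⊢
        omega
      by_cases hx : x = i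
      · subst hx
        obtain ⟨y, rfl⟩ : ∃ y, x = y + 1 := ⟨x - 1, by omega⟩
        have hdi := hd y
        rw [countP_le_succ (y+1)]
        have q1 : (R1 ++ (y+1) :: R2).countP (· ≤ y+1) = (R1 ++ (y+1+1) :: R2).countP (· ≤ y+1) + 1 := by
          simp only [List.countP_append, List.countP_cons, decide_eq_true_eq]
          split_ifs <;> omega
        rw [countP_le_succ y] at q1
        have q2 : (R1 ++ (y+1) :: R2).count (y+1) ≥ R1.count (y+1) + 1 := by
          simp
        rw [g2] at hdi
        omega
      · have : (R1 ++ (i+1) :: R2).countP (· ≤ x) = (R1 ++ i :: R2).countP (· ≤ x) := by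
          simp only [List.countP_append, List.countP_cons, decide_eq_true_eq]
          split_ifs <;> omega
        rw [this, ← g2]
        exact hd x
    · by_cases h2 : r' + 1 = r
      · subst h2
        rw [Function.update_self, Function.update_of_ne (by omega)]
        refine (hcnt _).trans ?_
        rw [← g2]
        exact hd x
      · rw [Function.update_of_ne (by omega), Function.update_of_ne (by omega)]
        exact hd x

/-- Row words of tableaux of rectangular shape. -/
def TW (w h : ℕ) (x : List ℕ) : Prop := ∃ R, TabF w h R ∧ x = wd h R

theorem ph_zero_prefix (i : ℕ) (s t : List ℕ) (h : ph i (s ++ t) = 0) : ph i s = 0 := by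
  induction s with
  | nil => rfl
  | cons a s ih =>
    have key : ∀ s : List ℕ, ph i s ≤ ph i (s ++ t) := by
      intro s
      induction s with
      | nil => simp [ph]
      | cons a s ih => simp only [List.cons_append, ph]; split_ifs <;> omega
    have := key (a :: s)
    omega

theorem pair_ee (w1 h1 w2 h2 i : ℕ) (hi : 1 ≤ i) (x y z : List ℕ) (hx : TW w1 h1 x)
    (hy : TW w2 h2 y) (h : ee i (x ++ y) = some z) :
    ∃ x' y', TW w1 h1 x' ∧ TW w2 h2 y' ∧ z = x' ++ y' := by
  obtain ⟨R, hR, rfl⟩ := hx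
  obtain ⟨S, hS, rfl⟩ := hy
  obtain ⟨u, v, e1, e2, e3, -, e5⟩ := ee_decomp _ _ _ h
  have : (∃ c, u = wd h1 R ++ c ∧ wd h2 S = c ++ (i+1) :: v) ∨
      (∃ c, wd h1 R = u ++ (i+1) :: c ∧ v = c ++ wd h2 S) := by
    rcases List.append_eq_append_iff.1 e1 with ⟨c, g1, g2⟩ | ⟨c, g1, g2⟩
    · exact Or.inl ⟨c, g1, g2⟩
    · rcases c with _ | ⟨a, c⟩
      · left
        exact ⟨[], by simpa using g1.symm, by simpa using g2.symm⟩
      · simp at g2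
        obtain ⟨rfl, g2⟩ := g2
        exact Or.inr ⟨c, g1, g2⟩
  rcases this with ⟨c, g1, g2⟩ | ⟨c, g1, g2⟩
  · obtain ⟨S', hS', q⟩ := tab_ee w2 h2 i hi S hS c v g2 e3
      (fun s hs => e5 s (hs.trans ⟨wd h1 R, g1.symm⟩))
    exact ⟨wd h1 R, wd h2 S', ⟨R, hR, rfl⟩, ⟨S', hS', rfl⟩, by rw [e2, g1, ← q]; simp⟩
  · obtain ⟨R', hR', q⟩ := tab_ee w1 h1 i hi R hR u c g1
      (ph_zero_prefix i c (wd h2 S) (by rw [← g2]; exact e3)) e5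
    exact ⟨wd h1 R', wd h2 S, ⟨R', hR', rfl⟩, ⟨S, hS, rfl⟩, by rw [e2, g2, ← q]; simp⟩

theorem pair_ff (w1 h1 w2 h2 i : ℕ) (hi : 1 ≤ i) (x y z : List ℕ) (hx : TW w1 h1 x)
    (hy : TW w2 h2 y) (h : ff i (x ++ y) = some z) :
    ∃ x' y', TW w1 h1 x' ∧ TW w2 h2 y' ∧ z = x' ++ y' := by
  obtain ⟨R, hR, rfl⟩ := hx
  obtain ⟨S, hS, rfl⟩ := hy
  obtain ⟨u, v, e2, e1, e3, -, e5⟩ := ee_decomp _ _ _ (ff_ee _ _ _ h).1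
  have : (∃ c, u = wd h1 R ++ c ∧ wd h2 S = c ++ i :: v) ∨
      (∃ c, wd h1 R = u ++ i :: c ∧ v = c ++ wd h2 S) := by
    rcases List.append_eq_append_iff.1 e1 with ⟨c, g1, g2⟩ | ⟨c, g1, g2⟩
    · exact Or.inl ⟨c, g1, g2⟩
    · rcases c with _ | ⟨a, c⟩
      · left
        exact ⟨[], by simpa using g1.symm, by simpa using g2.symm⟩
      · simp at g2
        obtain ⟨rfl, g2⟩ := g2
        exact Or.inr ⟨c, g1, g2⟩
  rcases this with ⟨c, g1, g2⟩ | ⟨c, g1, g2⟩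
  · obtain ⟨S', hS', q⟩ := tab_ff w2 h2 i hi S hS c v g2 e3
      (fun s hs => e5 s (hs.trans ⟨wd h1 R, g1.symm⟩))
    exact ⟨wd h1 R, wd h2 S', ⟨R, hR, rfl⟩, ⟨S', hS', rfl⟩, by rw [e2, g1, ← q]; simp⟩
  · obtain ⟨R', hR', q⟩ := tab_ff w1 h1 i hi R hR u c g1
      (ph_zero_prefix i c (wd h2 S) (by rw [← g2]; exact e3)) e5
    exact ⟨wd h1 R', wd h2 S, ⟨R', hR', rfl⟩, ⟨S, hS, rfl⟩, by rw [e2, g2, ← q]; simp⟩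

theorem wd_suffix (r h : ℕ) (hr : r ≤ h) (R : ℕ → List ℕ) : wd r R <:+ wd h R := by
  induction h, hr using Nat.le_induction with
  | base => exact List.suffix_rfl
  | succ h _ ih => exact ih.trans (List.suffix_append _ _)

theorem wd_pos {w h : ℕ} {R : ℕ → List ℕ} (hR : TabF w h R) (r : ℕ) (hr : r ≤ h) :
    ∀ a ∈ wd r R, 1 ≤ a := by
  induction r with
  | zero => simp [wd]
  | succ r ih =>
    intro a ha
    simp only [wd, List.mem_append] at ha
    rcases ha with ha | ha
    · exact hR.pos r (by omega) a ha
    · exact ih (by omega) a ha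

theorem wd_length {w h : ℕ} {R : ℕ → List ℕ} (hR : TabF w h R) (r : ℕ) (hr : r ≤ h) :
    (wd r R).length = r * w := by
  induction r with
  | zero => simp [wd]
  | succ r ih =>
    simp only [wd, List.length_append, ih (by omega), hR.len r (by omega)]
    ring

theorem tw_pos {w h : ℕ} {x : List ℕ} (hx : TW w h x) : ∀ a ∈ x, 1 ≤ a := by
  obtain ⟨R, hR, rfl⟩ := hx
  exact wd_pos hR h le_rfl

theorem tw_length {w h : ℕ} {x : List ℕ} (hx : TW w h x) : x.length = h * w := by
  obtain ⟨R, hR, rfl⟩ := hx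
  exact wd_length hR h le_rfl

theorem hw_row {w h : ℕ} {R : ℕ → List ℕ} (hR : TabF w h R) (y : List ℕ) (hw : HW (wd h R ++ y))
    (r v : ℕ) (hr : r < h) (hv : 1 ≤ v) :
    (wd (r+1) R).count (v+1) + y.count (v+1) ≤ (wd r R).count v + y.count v := by
  obtain ⟨A, B, hAB, hA, hB⟩ := sorted_split v _ (hR.srt r hr)
  obtain ⟨t, ht⟩ := wd_suffix (r+1) h hr R
  have hq := hw v hv (B ++ wd r R ++ y) ⟨t ++ A, by rw [← ht]; simp [wd, hAB]⟩
  have c1 : A.count (v+1) = 0 := by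
    rw [List.count_eq_zero]
    intro hm; have := hA _ hm; omega
  have c2 : B.count v = 0 := by
    rw [List.count_eq_zero]
    intro hm; have := hB _ hm; omega
  simp only [wd, hAB, List.count_append] at hq ⊢
  omega

theorem low {w h : ℕ} {R : ℕ → List ℕ} (hR : TabF w h R) (r : ℕ) (hr : r < h) :
    (R r).countP (· ≤ r) = 0 := by
  induction r with
  | zero =>
    rw [List.countP_eq_zero]
    intro a ha
    have := hR.pos 0 hr a ha
    simp; omega
  | succ r ih =>
    have := hR.dom r hr r
    have := ih (by omega)
    omega

theorem countP_mono_le (L : List ℕ) {a b : ℕ} (h : a ≤ b) :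
    L.countP (· ≤ a) ≤ L.countP (· ≤ b) :=
  List.countP_mono_left (fun x _ hx => by simp at hx ⊢; omega)

theorem count_le_countP (L : List ℕ) (a : ℕ) : L.count a ≤ L.countP (· ≤ a) := by
  rw [List.count]
  exact List.countP_mono_left (fun x _ hx => by simp at hx ⊢; omega)

theorem countP_const (L : List ℕ) (a b : ℕ) (h : a ≤ b) (h0 : ∀ v, a < v → v ≤ b → L.count v = 0) :
    L.countP (· ≤ b) = L.countP (· ≤ a) := by
  induction b, h using Nat.le_induction with
  | base => rfl
  | succ b hb ih =>
    rw [countP_le_succ, ih (fun v h1 h2 => h0 v h1 (by omega)), h0 (b+1) (by omega) le_rfl, add_zero]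

theorem countP_sum (L : List ℕ) (H k : ℕ) :
    L.countP (· ≤ H + k) = L.countP (· ≤ H) + ∑ j ∈ Finset.range k, L.count (H + 1 + j) := by
  induction k with
  | zero => simp
  | succ k ih =>
    have := countP_le_succ (H + k) L
    have e : H + 1 + k = H + k + 1 := by omega
    rw [Finset.sum_range_succ, ← add_assoc H k 1, this, ih, e]
    omega

/-- Profile of the second factor. -/
def Prof (W H : ℕ) (y : List ℕ) : Prop :=
  (∀ v, 1 ≤ v → v ≤ H → y.count v = W) ∧ (∀ v, H < v → y.count v = 0)

/-- Shifted sequence. -/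
def shf (w : ℕ) (a : ℕ → ℕ) : ℕ → ℕ
  | 0 => w
  | k + 1 => a k

theorem core_high0 {w h W H : ℕ} {R : ℕ → List ℕ} (hR : TabF w h R) {y : List ℕ}
    (hy : Prof W H y) (hw : HW (wd h R ++ y)) (r : ℕ) (hr : r ≤ h) :
    ∀ j, r ≤ j → (wd r R).count (H + 1 + j) = 0 := by
  induction r with
  | zero => simp [wd]
  | succ r ih =>
    intro j hj
    obtain ⟨k, rfl⟩ : ∃ k, j = k + 1 := ⟨j - 1, by omega⟩
    have h1 := hw_row hR y hw r (H + 1 + k) (by omega) (by omega)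
    rw [hy.2 _ (by omega), hy.2 _ (by omega), ih (by omega) k (by omega)] at h1
    rw [← add_assoc]; omega

theorem core_low0 {w h W H : ℕ} {R : ℕ → List ℕ} (hR : TabF w h R) {y : List ℕ}
    (hy : Prof W H y) (hw : HW (wd h R ++ y)) (r : ℕ) (hr : r ≤ h) :
    ∀ v, r < v → v ≤ H → (wd r R).count v = 0 := by
  induction r with
  | zero => simp [wd]
  | succ r ih =>
    intro v hv hv2
    obtain ⟨k, rfl⟩ : ∃ k, v = k + 1 := ⟨v - 1, by omega⟩
    have h1 := hw_row hR y hw r k (by omega) (by omega)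
    rw [hy.1 _ (by omega) (by omega), hy.1 _ (by omega) (by omega), ih (by omega) k (by omega) (by omega)] at h1
    omega

theorem core_high {w h W H : ℕ} {R : ℕ → List ℕ} (hR : TabF w h R) {y : List ℕ}
    (hy : Prof W H y) (hw : HW (wd h R ++ y)) (r : ℕ) (hr : r ≤ h) :
    ∀ j, j ≤ r → (wd r R).count (H + 1 + j) + shf w (fun k => (R k).countP (· ≤ H)) (r - j) = w := by
  set A := shf w (fun k => (R k).countP (· ≤ H)) with hA
  induction r with
  | zero => intro j hj; simp [wd, hA, shf]
  | succ r ih =>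
    have ih := ih (by omega)
    have hle : ∀ j, j ≤ r + 1 → (wd (r+1) R).count (H + 1 + j) + A (r + 1 - j) ≤ w := by
      intro j hj
      rcases j with _ | j
      · have h0 := ih 0 (by omega)
        have h1 : (R r).countP (· ≤ H + 1) ≤ A r := by
          rcases r with _ | r
          · simp only [hA, shf]
            rw [← hR.len 0 (by omega)]
            exact List.countP_le_length
          · exact hR.dom r (by omega) H
        rw [countP_le_succ] at h1
        simp only [wd, List.count_append] at h0 ⊢
        have h2 : A (r + 1) = (R r).countP (· ≤ H) := rfl
        simp only [Nat.sub_zero, add_zero] at h0 ⊢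
        omega
      · have h1 := hw_row hR y hw r (H + 1 + j) (by omega) (by omega)
        rw [hy.2 _ (by omega), hy.2 _ (by omega)] at h1
        have h0 := ih j (by omega)
        rw [show r + 1 - (j + 1) = r - j by omega, ← add_assoc]
        omega
    have hlen : (R r).countP (· ≤ H) + ∑ j ∈ Finset.range (r+1), (R r).count (H + 1 + j) = w := by
      rw [← countP_sum, ← hR.len r (by omega), List.countP_eq_length]
      intro a ha
      by_contra hc
      simp at hc
      have h0 := core_high0 hR hy hw (r+1) hr (a - H - 1) (by omega)
      rw [show H + 1 + (a - H - 1) = a by omega] at h0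
      simp only [wd, List.count_append] at h0
      have := List.count_pos_iff.2 ha
      omega
    have hsum : ∑ j ∈ Finset.range (r+1), ((wd (r+1) R).count (H + 1 + j) + A (r + 1 - j)) =
        ∑ j ∈ Finset.range (r+1), w := by
      have e1 : ∑ j ∈ Finset.range (r+1), ((wd r R).count (H + 1 + j) + A (r - j)) =
          ∑ j ∈ Finset.range (r+1), w :=
        Finset.sum_congr rfl (fun j hj => ih j (by simp at hj; omega))
      have e2 : ∑ j ∈ Finset.range (r+1), A (r + 1 - j) = A (r+1) + ∑ j ∈ Finset.range r, A (r - j) := by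
        rw [Finset.sum_range_succ', add_comm]
        congr 1
        exact Finset.sum_congr rfl (fun j hj => by congr 1; omega)
      have e3 : ∑ j ∈ Finset.range (r+1), A (r - j) = ∑ j ∈ Finset.range r, A (r - j) + w := by
        rw [Finset.sum_range_succ]; simp [hA, shf]
      have h2 : A (r + 1) = (R r).countP (· ≤ H) := rfl
      simp only [wd, List.count_append, Finset.sum_add_distrib] at e1 e2 e3 ⊢
      omega
    have heq := (Finset.sum_eq_sum_iff_of_le (fun j hj => hle j (by simp at hj; omega))).1 hsum
    intro j hj
    rcases Nat.lt_or_ge j (r+1) with h | h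
    · exact heq j (by simpa using h)
    · have : j = r + 1 := by omega
      subst this
      rw [core_high0 hR hy hw (r+1) hr (r+1) le_rfl]
      simp [hA, shf]

theorem core_anti {w h H : ℕ} {R : ℕ → List ℕ} (hR : TabF w h R) (r : ℕ) (hr : r + 1 < h) :
    (R (r+1)).countP (· ≤ H) ≤ (R r).countP (· ≤ H) :=
  (countP_mono_le _ (Nat.le_succ H)).trans (hR.dom r hr H)

theorem core_zero {w h H : ℕ} {R : ℕ → List ℕ} (hR : TabF w h R) (r : ℕ) (hr : r < h) (hH : H ≤ r) :
    (R r).countP (· ≤ H) = 0 := by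
  have := countP_mono_le (R r) hH
  have := low hR r hr
  omega

theorem core_low {w h W H : ℕ} {R : ℕ → List ℕ} (hR : TabF w h R) {y : List ℕ}
    (hy : Prof W H y) (hw : HW (wd h R ++ y)) (r : ℕ) (hr : r ≤ h) :
    ∀ v, 1 ≤ v → v ≤ H → v ≤ r → (wd r R).count v = (R (v-1)).countP (· ≤ H) := by
  induction r with
  | zero => intro v h1 h2 h3; omega
  | succ r ih =>
    intro v h1 h2 h3
    simp only [wd, List.count_append]
    rcases Nat.lt_or_ge r v with h | h
    · have : v = r + 1 := by omega
      subst this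
      rw [core_low0 hR hy hw r (by omega) (r+1) (by omega) h2, Nat.add_sub_cancel,
        countP_const (R r) (r+1) H h2, countP_le_succ, low hR r (by omega)]
      · omega
      · intro v hv hv2
        have := core_low0 hR hy hw (r+1) (by omega) v hv hv2
        simp only [wd, List.count_append] at this
        omega
    · rw [ih (by omega) v h1 h2 h]
      have := count_le_countP (R r) v
      have := countP_mono_le (R r) h
      have := low hR r (by omega)
      omega

theorem core_bound {w h W H : ℕ} {R : ℕ → List ℕ} (hR : TabF w h R) {y : List ℕ}
    (hy : Prof W H y) (hw : HW (wd h R ++ y)) (r : ℕ) (hr : r < h) (hH : r < H) :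
    w ≤ W + (R r).countP (· ≤ H) := by
  have h1 := hw_row hR y hw r H hr (by omega)
  have h2 := core_high hR hy hw (r+1) hr 0 (by omega)
  rw [hy.1 H (by omega) le_rfl, core_low0 hR hy hw r (by omega) H hH le_rfl] at h1
  simp only [shf, Nat.sub_zero, add_zero] at h2
  omega

theorem prof_cnt {W H : ℕ} {S : ℕ → List ℕ} (hS : TabF W H S) (hw : HW (wd H S))
    (r : ℕ) (hr : r ≤ H) (v : ℕ) (hv : 1 ≤ v) : (wd r S).count v = if v ≤ r then W else 0 := by
  have hp : Prof 0 0 [] := ⟨by simp, by simp⟩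
  have hw' : HW (wd H S ++ []) := by simpa using hw
  obtain ⟨j, rfl⟩ : ∃ j, v = 0 + 1 + j := ⟨v - 1, by omega⟩
  split_ifs with h
  · have h1 := core_high hS hp hw' r hr j (by omega)
    obtain ⟨k, hk⟩ : ∃ k, r - j = k + 1 := ⟨r - j - 1, by omega⟩
    rw [hk] at h1
    simp only [shf] at h1
    rw [core_zero hS k (by omega) (by omega)] at h1
    omega
  · exact core_high0 hS hp hw' r hr j (by omega)

theorem prof_of_hw {W H : ℕ} {S : ℕ → List ℕ} (hS : TabF W H S) (hw : HW (wd H S)) :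
    Prof W H (wd H S) :=
  ⟨fun v h1 h2 => by rw [prof_cnt hS hw H le_rfl v h1, if_pos h2],
   fun v h => by rw [prof_cnt hS hw H le_rfl v (by omega), if_neg (by omega)]⟩

theorem hw_suffix {x y : List ℕ} (h : HW (x ++ y)) : HW y :=
  fun i hi s hs => h i hi s (hs.trans (List.suffix_append _ _))

theorem wd_eq_of_counts {w h : ℕ} {R R' : ℕ → List ℕ} (hR : TabF w h R) (hR' : TabF w h R')
    (hc : ∀ r, r ≤ h → ∀ v, 1 ≤ v → (wd r R).count v = (wd r R').count v) : wd h R = wd h R' := by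
  apply wd_congr
  intro r hr
  have hp : (R r).Perm (R' r) := by
    rw [List.perm_iff_count]
    intro v
    rcases Nat.eq_zero_or_pos v with rfl | hv
    · rw [List.count_eq_zero.2, List.count_eq_zero.2]
      · intro hm; have := hR'.pos r hr 0 hm; omega
      · intro hm; have := hR.pos r hr 0 hm; omega
    · have h1 := hc (r+1) hr v hv
      have h2 := hc r (by omega) v hv
      simp only [wd, List.count_append] at h1
      omega
  exact hp.eq_of_pairwise (fun a b _ _ h1 h2 => le_antisymm h1 h2) (hR.srt r hr) (hR'.srt r hr)

theorem hw_pair_uniq {w1 h1 w2 h2 : ℕ} {x y x' y' : List ℕ} (hx : TW w1 h1 x) (hy : TW w2 h2 y)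
    (hx' : TW w1 h1 x') (hy' : TW w2 h2 y') (hw : HW (x ++ y)) (hw' : HW (x' ++ y'))
    (hp : (x ++ y).Perm (x' ++ y')) : x = x' ∧ y = y' := by
  obtain ⟨R, hR, rfl⟩ := hx
  obtain ⟨S, hS, rfl⟩ := hy
  obtain ⟨R', hR', rfl⟩ := hx'
  obtain ⟨S', hS', rfl⟩ := hy'
  have k1 := hw_suffix hw
  have k2 := hw_suffix hw'
  have hyy : wd h2 S = wd h2 S' := by
    apply wd_eq_of_counts hS hS'
    intro r hr v hv
    rw [prof_cnt hS k1 r hr v hv, prof_cnt hS' k2 r hr v hv]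
  refine ⟨?_, hyy⟩
  rw [← hyy] at hp hw'
  have hy := prof_of_hw hS k1
  have hp1 : (wd h1 R).Perm (wd h1 R') := (List.perm_append_right_iff _).1 hp
  have ha : ∀ k, k < h1 → (R k).countP (· ≤ h2) = (R' k).countP (· ≤ h2) := by
    intro k hk
    rcases Nat.lt_or_ge k h2 with h | h
    · have e1 := core_low hR hy hw h1 le_rfl (k+1) (by omega) (by omega) (by omega)
      have e2 := core_low hR' hy hw' h1 le_rfl (k+1) (by omega) (by omega) (by omega)
      rw [hp1.count_eq] at e1
      simp only [Nat.add_sub_cancel] at e1 e2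
      omega
    · rw [core_zero hR k hk h, core_zero hR' k hk h]
  apply wd_eq_of_counts hR hR'
  intro r hr v hv
  rcases Nat.lt_or_ge h2 v with h | h
  · obtain ⟨j, rfl⟩ : ∃ j, v = h2 + 1 + j := ⟨v - h2 - 1, by omega⟩
    rcases Nat.lt_or_ge j r with h' | h'
    · have e1 := core_high hR hy hw r hr j (by omega)
      have e2 := core_high hR' hy hw' r hr j (by omega)
      obtain ⟨k, hk⟩ : ∃ k, r - j = k + 1 := ⟨r - j - 1, by omega⟩
      rw [hk] at e1 e2
      simp only [shf] at e1 e2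
      rw [ha k (by omega)] at e1
      omega
    · rw [core_high0 hR hy hw r hr j h', core_high0 hR' hy hw' r hr j h']
  · rcases Nat.lt_or_ge r v with h' | h'
    · rw [core_low0 hR hy hw r hr v h' h, core_low0 hR' hy hw' r hr v h' h]
    · rw [core_low hR hy hw r hr v hv h h', core_low hR' hy hw' r hr v hv h h', ha _ (by omega)]

theorem ee_sum (i : ℕ) (w w' : List ℕ) (h : ee i w = some w') : w'.sum < w.sum := by
  obtain ⟨u, v, e1, e2, -⟩ := ee_decomp _ _ _ h
  rw [e1, e2]; simp

theorem oke_some {a : List ℕ} {o : Option (List ℕ)} (h : OKE (some a) o) :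
    ∃ b, o = some b ∧ KnuthEquiv a b := by
  cases o with
  | none => simp [OKE] at h
  | some b => exact ⟨b, rfl, h⟩

theorem pair_uniq {w1 h1 w2 h2 : ℕ} (N : ℕ) : ∀ x y x' y' : List ℕ, (x ++ y).sum ≤ N →
    TW w1 h1 x → TW w2 h2 y → TW w1 h1 x' → TW w2 h2 y' → KnuthEquiv (x ++ y) (x' ++ y') →
    x = x' ∧ y = y' := by
  induction N with
  | zero =>
    intro x y x' y' hN hx hy hx' hy' hk
    have hw : HW (x ++ y) := by
      by_contra hc
      obtain ⟨i, z, _, hz⟩ := not_hw _ hc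
      have := ee_sum _ _ _ hz
      omega
    exact hw_pair_uniq hx hy hx' hy' hw (hw_ke hk hw) (ke_perm hk)
  | succ N ih =>
    intro x y x' y' hN hx hy hx' hy' hk
    by_cases hw : HW (x ++ y)
    · exact hw_pair_uniq hx hy hx' hy' hw (hw_ke hk hw) (ke_perm hk)
    · obtain ⟨i, z, hi, hz⟩ := not_hw _ hw
      have hs := ee_sum _ _ _ hz
      have ho := ee_ke i hk
      rw [hz] at ho
      obtain ⟨z', hz', hzk⟩ := oke_some ho
      obtain ⟨a, b, ha, hb, rfl⟩ := pair_ee _ _ _ _ i hi _ _ _ hx hy hz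
      obtain ⟨a', b', ha', hb', rfl⟩ := pair_ee _ _ _ _ i hi _ _ _ hx' hy' hz'
      obtain ⟨rfl, rfl⟩ := ih a b a' b' (by omega) ha hb ha' hb' hzk
      have e1 := (ee_ff _ _ _ hz).1
      have e2 := (ee_ff _ _ _ hz').1
      rw [e1] at e2
      exact List.append_inj (Option.some.inj e2) (by rw [tw_length hx, tw_length hx'])

theorem row_hw {v L : List ℕ} (hv : HW v)
    (h : ∀ i, 1 ≤ i → L.count (i+1) + v.count (i+1) ≤ v.count i) : HW (L ++ v) := by
  intro i hi s hs
  obtain ⟨t, e⟩ := hs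
  rcases List.append_eq_append_iff.1 e with ⟨c, g1, g2⟩ | ⟨c, g1, g2⟩
  · have := h i hi
    rw [g1] at this
    rw [g2]
    simp only [List.count_append] at this ⊢
    omega
  · exact hv i hi s ⟨c, g2.symm⟩

/-- Sorted row with prescribed cumulative counts. -/
def rowOf (F : ℕ → ℕ) : ℕ → List ℕ
  | 0 => []
  | K + 1 => rowOf F K ++ List.replicate (F (K+1) - F K) (K+1)

theorem rowOf_le (F : ℕ → ℕ) (K : ℕ) : ∀ a ∈ rowOf F K, 1 ≤ a ∧ a ≤ K := by
  induction K with
  | zero => simp [rowOf]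
  | succ K ih =>
    intro a ha
    simp only [rowOf, List.mem_append, List.mem_replicate] at ha
    rcases ha with ha | ha
    · have := ih a ha; omega
    · omega

theorem rowOf_srt (F : ℕ → ℕ) (K : ℕ) : (rowOf F K).Pairwise (· ≤ ·) := by
  induction K with
  | zero => simp [rowOf]
  | succ K ih =>
    simp only [rowOf, List.pairwise_append]
    refine ⟨ih, ?_, ?_⟩
    · rw [List.pairwise_replicate]; simp
    · intro a ha b hb
      have := rowOf_le F K a ha
      have := List.eq_of_mem_replicate hb
      omega

theorem rowOf_len (F : ℕ → ℕ) (h0 : F 0 = 0) (hm : ∀ v, F v ≤ F (v+1)) (K : ℕ) :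
    (rowOf F K).length = F K := by
  induction K with
  | zero => simp [rowOf, h0]
  | succ K ih =>
    have := hm K
    simp only [rowOf, List.length_append, List.length_replicate, ih]
    omega

theorem rowOf_count (F : ℕ → ℕ) (K v : ℕ) (hv : v < K) :
    (rowOf F K).count (v+1) = F (v+1) - F v := by
  induction K with
  | zero => omega
  | succ K ih =>
    simp only [rowOf, List.count_append, List.count_replicate]
    rcases Nat.lt_or_ge v K with h | h
    · rw [ih h]
      have : ¬ (K + 1 = v + 1) := by omega
      simp; omega
    · have : v = K := by omega
      subst this
      have : (rowOf F v).count (v+1) = 0 := by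
        rw [List.count_eq_zero]
        intro hm; have := rowOf_le F v _ hm; omega
      simp [this]

theorem rowOf_countP (F : ℕ → ℕ) (h0 : F 0 = 0) (hm : ∀ v, F v ≤ F (v+1)) (K v : ℕ) (hv : v ≤ K) :
    (rowOf F K).countP (· ≤ v) = F v := by
  induction v with
  | zero =>
    rw [h0, List.countP_eq_zero]
    intro a ha
    have := rowOf_le F K a ha
    simp; omega
  | succ v ih =>
    rw [countP_le_succ, ih (by omega), rowOf_count F K v (by omega)]
    have := hm v
    omega

/-- Cumulative counts of the rows of the swapped highest weight tableau. -/
def FF (W h : ℕ) (b : ℕ → ℕ) (r v : ℕ) : ℕ :=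
  if v ≤ h then (if r + 1 ≤ v then b r else 0) else shf W b (r + 1 - (v - h))

theorem shf_anti {W : ℕ} {b : ℕ → ℕ} (hb : ∀ r, b (r+1) ≤ b r) (hW : ∀ r, b r ≤ W) (k : ℕ) :
    shf W b (k+1) ≤ shf W b k := by
  cases k with
  | zero => exact hW 0
  | succ k => exact hb k

theorem FF_le {W h : ℕ} {b : ℕ → ℕ} {r v : ℕ} (hv : v ≤ h) :
    FF W h b r v = if r + 1 ≤ v then b r else 0 := by
  rw [FF, if_pos hv]

theorem FF_gt {W h : ℕ} {b : ℕ → ℕ} {r v : ℕ} (hv : h < v) :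
    FF W h b r v = shf W b (r + 1 - (v - h)) := by
  rw [FF, if_neg (by omega)]

theorem FF_mono {W h : ℕ} {b : ℕ → ℕ} (hb : ∀ r, b (r+1) ≤ b r) (hW : ∀ r, b r ≤ W) (r v : ℕ) :
    FF W h b r v ≤ FF W h b r (v+1) := by
  rcases Nat.lt_trichotomy v h with hv | rfl | hv
  · rw [FF_le (by omega), FF_le (by omega)]
    split_ifs <;> omega
  · rw [FF_le le_rfl, FF_gt (by omega), show r + 1 - (v + 1 - v) = r by omega]
    have : b r ≤ shf W b r := shf_anti hb hW r
    split_ifs <;> omega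
  · rw [FF_gt (by omega), FF_gt (by omega)]
    rcases Nat.lt_or_ge (v - h) (r + 1) with h1 | h1
    · have := shf_anti hb hW (r - (v - h))
      rwa [show r - (v - h) + 1 = r + 1 - (v - h) by omega,
        show r - (v - h) = r + 1 - (v + 1 - h) by omega] at this
    · rw [show r + 1 - (v - h) = r + 1 - (v + 1 - h) by omega]

/-- Rows of the swapped highest weight tableau. -/
def RR (W h H : ℕ) (b : ℕ → ℕ) (r : ℕ) : List ℕ := rowOf (FF W h b r) (h + H + 1)

theorem FF_top {W h : ℕ} {b : ℕ → ℕ} (r v : ℕ) (hv : h + r + 1 ≤ v) : FF W h b r v = W := by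
  unfold FF
  rw [if_neg (by omega), show r + 1 - (v - h) = 0 by omega]
  rfl

theorem FF_zero {W h : ℕ} {b : ℕ → ℕ} (r : ℕ) : FF W h b r 0 = 0 := by
  simp [FF]

theorem RR_countP {W h H : ℕ} {b : ℕ → ℕ} (hb : ∀ r, b (r+1) ≤ b r) (hW : ∀ r, b r ≤ W)
    (r v : ℕ) (hr : r < H) : (RR W h H b r).countP (· ≤ v) = FF W h b r v := by
  rcases Nat.lt_or_ge v (h + H + 2) with h1 | h1
  · exact rowOf_countP _ (FF_zero r) (FF_mono hb hW r) _ v (by omega)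
  · have hl := rowOf_len _ (FF_zero (W := W) (h := h) (b := b) r) (FF_mono hb hW r) (h + H + 1)
    rw [FF_top r _ (by omega)] at hl
    rw [FF_top r v (by omega), List.countP_eq_length.2]
    · exact hl
    · intro a ha
      have := rowOf_le _ _ a ha
      simp; omega

theorem RR_count {W h H : ℕ} {b : ℕ → ℕ} (hb : ∀ r, b (r+1) ≤ b r) (hW : ∀ r, b r ≤ W)
    (r v : ℕ) (hr : r < H) : (RR W h H b r).count (v+1) + FF W h b r v = FF W h b r (v+1) := by
  rw [← RR_countP hb hW r (v+1) hr, ← RR_countP hb hW r v hr, countP_le_succ]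
  omega

theorem RR_tab {W h H : ℕ} {b : ℕ → ℕ} (hb : ∀ r, b (r+1) ≤ b r) (hW : ∀ r, b r ≤ W)
    (h0 : ∀ r, h ≤ r → b r = 0) : TabF W H (RR W h H b) := by
  constructor
  · intro r hr
    rw [RR, rowOf_len _ (FF_zero r) (FF_mono hb hW r), FF_top r _ (by omega)]
  · intro r hr
    exact rowOf_srt _ _
  · intro r hr a ha
    exact (rowOf_le _ _ a ha).1
  · intro r hr v
    rw [RR_countP hb hW _ _ hr, RR_countP hb hW _ _ (by omega)]
    rcases Nat.lt_trichotomy v h with hv | rfl | hv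
    · rw [FF_le (by omega), FF_le (by omega)]
      have := hb r
      split_ifs <;> omega
    · rw [FF_le (v := v) le_rfl, FF_gt (by omega), show r + 1 + 1 - (v + 1 - v) = r + 1 by omega]
      simp only [shf]
      have := h0 r
      split_ifs
      · omega
      · have := this (by omega); omega
    · rw [FF_gt (by omega), FF_gt (by omega),
        show r + 1 + 1 - (v + 1 - h) = r + 1 - (v - h) by omega]

theorem RR_low {W h H : ℕ} {b : ℕ → ℕ} (hb : ∀ r, b (r+1) ≤ b r) (hW : ∀ r, b r ≤ W)
    (r : ℕ) (hr : r ≤ H) (u : ℕ) (hu : u < h) :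
    (wd r (RR W h H b)).count (u+1) = if u < r then b u else 0 := by
  induction r with
  | zero => simp [wd]
  | succ r ih =>
    have h1 := RR_count (h := h) hb hW r u (by omega : r < H)
    rw [FF_le (show u ≤ h by omega), FF_le (show u + 1 ≤ h by omega)] at h1
    simp only [wd, List.count_append, ih (by omega)]
    rcases Nat.lt_trichotomy u r with hv | rfl | hv
    · rw [if_pos hv, if_pos (by omega)]
      split_ifs at h1 <;> omega
    · rw [if_neg (by omega), if_pos (by omega)]
      split_ifs at h1 <;> omega
    · rw [if_neg (show ¬ u < r by omega), if_neg (by omega)]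
      split_ifs at h1 <;> omega

theorem RR_high {W h H : ℕ} {b : ℕ → ℕ} (hb : ∀ r, b (r+1) ≤ b r) (hW : ∀ r, b r ≤ W)
    (h0 : ∀ r, h ≤ r → b r = 0)
    (r : ℕ) (hr : r ≤ H) (j : ℕ) :
    (wd r (RR W h H b)).count (h + j + 1) + shf W b (r - j) = W := by
  induction r with
  | zero => simp [wd, shf]
  | succ r ih =>
    have h1 := RR_count (h := h) hb hW r (h + j) (by omega : r < H)
    have ih := ih (by omega)
    simp only [wd, List.count_append]
    unfold FF at h1
    rw [if_neg (show ¬ (h + j + 1 ≤ h) by omega), show r + 1 - (h + j + 1 - h) = r - j by omega] at h1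
    rcases j with _ | j
    · rw [if_pos (by omega)] at h1
      simp only [shf, Nat.sub_zero, add_zero] at h1 ih ⊢
      have := h0 r
      split_ifs at h1
      · omega
      · have := this (by omega); omega
    · rw [if_neg (by omega), show r + 1 - (h + (j + 1) - h) = r + 1 - (j + 1) by omega] at h1
      omega

theorem RR_hw {W w h H : ℕ} {b : ℕ → ℕ} (hb : ∀ r, b (r+1) ≤ b r) (hW : ∀ r, b r ≤ W)
    (h0 : ∀ r, h ≤ r → b r = 0) (hq : ∀ r, r < h → r < H → W ≤ w + b r) {y : List ℕ}
    (hy : Prof w h y) (hyw : HW y) (r : ℕ) (hr : r ≤ H) : HW (wd r (RR W h H b) ++ y) := by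
  induction r with
  | zero => simpa [wd] using hyw
  | succ r ih =>
    simp only [wd, List.append_assoc]
    apply row_hw (ih (by omega))
    intro i hi
    have key : (wd (r+1) (RR W h H b)).count (i+1) + y.count (i+1) ≤
        (wd r (RR W h H b)).count i + y.count i := by
      obtain ⟨k, rfl⟩ : ∃ k, i = k + 1 := ⟨i - 1, by omega⟩
      rcases Nat.lt_trichotomy (k+1) h with hv | rfl | hv
      · rw [RR_low hb hW (r+1) hr (k+1) hv, RR_low hb hW r (by omega) k (by omega),
          hy.1 (k+1+1) (by omega) (by omega), hy.1 (k+1) (by omega) (by omega)]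
        have := hb k
        split_ifs <;> omega
      · have e1 := RR_high hb hW h0 (r+1) hr 0
        rw [RR_low hb hW r (by omega) k (by omega),
          hy.1 (k+1) (by omega) (by omega), hy.2 (k+1+1) (by omega)]
        simp only [shf, Nat.sub_zero, add_zero] at e1 ⊢
        split_ifs with hk
        · have := hq k (by omega) (by omega); omega
        · have := hq r (by omega) (by omega); omega
      · obtain ⟨j, rfl⟩ : ∃ j, k = h + j := ⟨k - h, by omega⟩
        have e1 := RR_high hb hW h0 (r+1) hr (j+1)
        have e2 := RR_high (H := H) hb hW h0 r (by omega) j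
        rw [hy.2 (h + j + 1 + 1) (by omega), hy.2 (h + j + 1) (by omega)]
        rw [show r + 1 - (j + 1) = r - j by omega, ← add_assoc] at e1
        omega
    simp only [wd, List.count_append] at key ⊢
    omega

theorem can_cnt (w : ℕ) (r v : ℕ) (hv : 1 ≤ v) :
    (wd r (fun k => List.replicate w (k+1))).count v = if v ≤ r then w else 0 := by
  induction r with
  | zero => rw [if_neg (by omega)]; simp [wd]
  | succ r ih =>
    simp only [wd, List.count_append, ih, List.count_replicate, beq_iff_eq]
    split_ifs <;> omega

theorem can_hw (w h : ℕ) : HW (wd h (fun k => List.replicate w (k+1))) := by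
  induction h with
  | zero =>
    intro i _ s hs
    simp [wd] at hs
    simp [hs]
  | succ h ih =>
    apply row_hw ih
    intro i hi
    rw [can_cnt _ _ _ hi, can_cnt _ _ _ (by omega), List.count_replicate]
    simp only [beq_iff_eq]
    split_ifs <;> omega

theorem can_tab (w h : ℕ) : TabF w h (fun k => List.replicate w (k+1)) := by
  constructor
  · intro r _; simp
  · intro r _; rw [List.pairwise_replicate]; simp
  · intro r _ a ha
    have := List.eq_of_mem_replicate ha
    omega
  · intro r _ v
    simp only [List.countP_replicate, decide_eq_true_eq]
    split_ifs <;> omega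

theorem hw_pair_exists {w1 h1 w2 h2 : ℕ} {x y : List ℕ} (hx : TW w1 h1 x) (hy : TW w2 h2 y)
    (hw : HW (x ++ y)) :
    ∃ x' y', TW w2 h2 x' ∧ TW w1 h1 y' ∧ KnuthEquiv (x' ++ y') (x ++ y) := by
  have hpx := tw_pos hx
  have hpy := tw_pos hy
  obtain ⟨R, hR, rfl⟩ := hx
  obtain ⟨S, hS, rfl⟩ := hy
  have hP := prof_of_hw hS (hw_suffix hw)
  obtain ⟨a, ha⟩ : ∃ a : ℕ → ℕ, a = fun k => (R k).countP (· ≤ h2) := ⟨_, rfl⟩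
  obtain ⟨b, hb⟩ : ∃ b : ℕ → ℕ, b = fun r => if r < h1 ∧ r < h2 then w2 + a r - w1 else 0 := ⟨_, rfl⟩
  have haw : ∀ r, r < h1 → a r ≤ w1 := by
    intro r hr
    rw [ha, ← hR.len r hr]
    exact List.countP_le_length
  have haa : ∀ r, r + 1 < h1 → a (r+1) ≤ a r := by
    intro r hr
    rw [ha]
    exact core_anti hR r hr
  have hab : ∀ r, r < h1 → r < h2 → w1 ≤ w2 + a r := by
    intro r hr hr2
    rw [ha]
    exact core_bound hR hP hw r hr hr2
  have ha0 : ∀ r, r < h1 → h2 ≤ r → a r = 0 := by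
    intro r hr hr2
    rw [ha]
    exact core_zero hR r hr hr2
  have b1 : ∀ r, b (r+1) ≤ b r := by
    intro r
    simp only [hb]
    have := haa r
    split_ifs
    · have := this (by omega); omega
    all_goals omega
  have b2 : ∀ r, b r ≤ w2 := by
    intro r
    simp only [hb]
    have := haw r
    split_ifs
    · have := this (by omega); omega
    all_goals omega
  have b3 : ∀ r, h1 ≤ r → b r = 0 := by
    intro r hr
    simp only [hb]
    rw [if_neg (by omega)]
  have b4 : ∀ r, r < h1 → r < h2 → b r + w1 = w2 + a r := by
    intro r hr hr2
    simp only [hb]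
    rw [if_pos ⟨hr, hr2⟩]
    have := hab r hr hr2
    omega
  have hyP := prof_of_hw (can_tab w1 h1) (can_hw w1 h1)
  have hw' := RR_hw b1 b2 b3 (fun r hr hr2 => by have := b4 r hr hr2; omega) hyP (can_hw w1 h1)
    h2 le_rfl
  have tx : TW w2 h2 (wd h2 (RR w2 h1 h2 b)) := ⟨_, RR_tab b1 b2 b3, rfl⟩
  have ty : TW w1 h1 (wd h1 (fun k => List.replicate w1 (k+1))) := ⟨_, can_tab w1 h1, rfl⟩
  refine ⟨_, _, tx, ty, hw_ke_of_perm _ _ hw' hw ?_ ?_⟩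
  · intro c hc
    rcases List.mem_append.1 hc with hc | hc
    · exact tw_pos tx c hc
    · exact tw_pos ty c hc
  · rw [List.perm_iff_count]
    intro v
    rcases Nat.eq_zero_or_pos v with rfl | hv
    · rw [List.count_eq_zero.2, List.count_eq_zero.2]
      · intro hm
        rcases List.mem_append.1 hm with hc | hc
        · have := hpx _ hc; omega
        · have := hpy _ hc; omega
      · intro hm
        rcases List.mem_append.1 hm with hc | hc
        · have := tw_pos tx _ hc; omega
        · have := tw_pos ty _ hc; omega
    simp only [List.count_append]
    have X1 := core_high hR hP hw h1 le_rfl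
    have X2 := core_low hR hP hw h1 le_rfl
    rw [← ha] at X1
    have X2 : ∀ v, 1 ≤ v → v ≤ h2 → v ≤ h1 → (wd h1 R).count v = a (v-1) := by
      rw [ha]; exact X2
    have X3 := core_low0 hR hP hw h1 le_rfl
    have X4 := core_high0 hR hP hw h1 le_rfl
    have Y1 := RR_low (h := h1) b1 b2 h2 le_rfl
    have Y2 := RR_high (h := h1) b1 b2 b3 h2 le_rfl
    rcases Nat.lt_or_ge h2 v with c1 | c1 <;> rcases Nat.lt_or_ge h1 v with c2 | c2
    · rw [hP.2 v c1, hyP.2 v c2]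
      obtain ⟨j, hj⟩ : ∃ j, v = h2 + 1 + j := ⟨v - h2 - 1, by omega⟩
      obtain ⟨i, hi⟩ : ∃ i, v = h1 + i + 1 := ⟨v - h1 - 1, by omega⟩
      have y2 := Y2 i
      rw [← hi] at y2
      rcases Nat.lt_or_ge j h1 with c3 | c3
      · have x1 := X1 j (by omega)
        rw [← hj] at x1
        obtain ⟨k, hk⟩ : ∃ k, h1 - j = k + 1 := ⟨h1 - j - 1, by omega⟩
        rw [hk] at x1
        rw [show h2 - i = k + 1 by omega] at y2
        simp only [shf] at x1 y2
        have := b4 k (by omega) (by omega)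
        omega
      · have x4 := X4 j c3
        rw [← hj] at x4
        rw [show h2 - i = 0 by omega] at y2
        simp only [shf] at y2
        omega
    · rw [hP.2 v c1, hyP.1 v hv c2]
      obtain ⟨j, hj⟩ : ∃ j, v = h2 + 1 + j := ⟨v - h2 - 1, by omega⟩
      obtain ⟨u, rfl⟩ : ∃ u, v = u + 1 := ⟨v - 1, by omega⟩
      have x1 := X1 j (by omega)
      rw [← hj] at x1
      obtain ⟨k, hk⟩ : ∃ k, h1 - j = k + 1 := ⟨h1 - j - 1, by omega⟩
      rw [hk] at x1
      simp only [shf] at x1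
      rw [ha0 k (by omega) (by omega)] at x1
      rw [Y1 u (by omega), if_neg (by omega)]
      omega
    · rw [hP.1 v hv c1, hyP.2 v c2, X3 v c2 c1]
      obtain ⟨i, hi⟩ : ∃ i, v = h1 + i + 1 := ⟨v - h1 - 1, by omega⟩
      have y2 := Y2 i
      rw [← hi] at y2
      obtain ⟨k, hk⟩ : ∃ k, h2 - i = k + 1 := ⟨h2 - i - 1, by omega⟩
      rw [hk] at y2
      simp only [shf] at y2
      rw [b3 k (by omega)] at y2
      omega
    · rw [hP.1 v hv c1, hyP.1 v hv c2, X2 v hv c1 c2]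
      obtain ⟨u, rfl⟩ : ∃ u, v = u + 1 := ⟨v - 1, by omega⟩
      rw [Y1 u (by omega), if_pos (by omega), Nat.add_sub_cancel]
      have := b4 u (by omega) (by omega)
      omega

theorem pair_exists {w1 h1 w2 h2 : ℕ} (N : ℕ) : ∀ x y : List ℕ, (x ++ y).sum ≤ N →
    TW w1 h1 x → TW w2 h2 y →
    ∃ x' y', TW w2 h2 x' ∧ TW w1 h1 y' ∧ KnuthEquiv (x' ++ y') (x ++ y) := by
  induction N with
  | zero =>
    intro x y hN hx hy
    have hw : HW (x ++ y) := by
      by_contra hc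
      obtain ⟨i, z, _, hz⟩ := not_hw _ hc
      have := ee_sum _ _ _ hz
      omega
    exact hw_pair_exists hx hy hw
  | succ N ih =>
    intro x y hN hx hy
    by_cases hw : HW (x ++ y)
    · exact hw_pair_exists hx hy hw
    · obtain ⟨i, z, hi, hz⟩ := not_hw _ hw
      have hs := ee_sum _ _ _ hz
      obtain ⟨a, b, ha, hb, rfl⟩ := pair_ee _ _ _ _ i hi _ _ _ hx hy hz
      obtain ⟨c, d, hc, hd, hk⟩ := ih a b (by omega) ha hb
      have ho := ff_ke i (ke_symm hk)
      rw [(ee_ff _ _ _ hz).1] at ho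
      obtain ⟨z', hz', hzk⟩ := oke_some ho
      obtain ⟨x', y', hx', hy', rfl⟩ := pair_ff _ _ _ _ i hi _ _ _ hc hd hz'
      exact ⟨x', y', hx', hy', ke_symm hzk⟩

theorem rWord_eq (w h : ℕ) (T : ℕ → ℕ → ℕ) :
    rWord w h T = wd h (fun r => (List.range w).map (T r)) := by
  induction h with
  | zero => rfl
  | succ h ih =>
    simp only [wd, ← ih]
    simp [rWord, List.range_succ]

theorem tabF_of_rect {n w h : ℕ} {T : ℕ → ℕ → ℕ} (hT : IsRectTab n w h T) :
    TabF w h (fun r => (List.range w).map (T r)) := by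
  obtain ⟨t1, t2, t3, t4⟩ := hT
  constructor
  · intro r _; simp
  · intro r hr
    rw [List.pairwise_map]
    have hm : ∀ d c, c + d < w → T r c ≤ T r (c + d) := by
      intro d
      induction d with
      | zero => intro c _; exact le_rfl
      | succ d ih =>
        intro c hc
        exact (ih c (by omega)).trans (t3 r (c+d) hr hc)
    refine List.pairwise_lt_range.imp_of_mem ?_
    intro a b _ hb hab
    have := hm (b - a) a (by simp at hb; omega)
    rwa [show a + (b - a) = b by omega] at this
  · intro r hr a ha
    simp only [List.mem_map, List.mem_range] at ha
    obtain ⟨c, hc, rfl⟩ := ha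
    exact (t2 r c hr hc).1
  · intro r hr v
    rw [List.countP_map, List.countP_map]
    apply List.countP_mono_left
    intro c hc hle
    have := t4 r c hr (by simpa using hc)
    simp at hle ⊢
    omega

theorem tw_of_rect {n w h : ℕ} {T : ℕ → ℕ → ℕ} (hT : IsRectTab n w h T) : TW w h (rWord w h T) :=
  ⟨_, tabF_of_rect hT, rWord_eq w h T⟩

theorem rect_le {n w h : ℕ} {T : ℕ → ℕ → ℕ} (hT : IsRectTab n w h T) :
    ∀ a ∈ rWord w h T, a ≤ n := by
  intro a ha
  simp only [rWord, List.mem_flatten, List.mem_map, List.mem_reverse, List.mem_range] at ha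
  obtain ⟨l, ⟨r, hr, rfl⟩, ha⟩ := ha
  simp only [List.mem_map, List.mem_range] at ha
  obtain ⟨c, hc, rfl⟩ := ha
  exact (hT.2.1 r c hr hc).2

theorem srt_get_le {L : List ℕ} (hL : L.Pairwise (· ≤ ·)) (c : ℕ) (hc : c < L.length) (v : ℕ) :
    L[c] ≤ v ↔ c + 1 ≤ L.countP (· ≤ v) := by
  have e : L = L.take c ++ L[c] :: L.drop (c+1) := by simp
  have hs := hL
  rw [e, List.pairwise_append, List.pairwise_cons] at hs
  obtain ⟨-, ⟨s2, -⟩, s3⟩ := hs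
  have hl : (L.take c).length = c := by simp; omega
  generalize hx : L[c] = x at *
  have e2 : L.countP (· ≤ v) = (L.take c).countP (· ≤ v) + (x :: L.drop (c+1)).countP (· ≤ v) := by
    conv_lhs => rw [e]
    rw [List.countP_append]
  rw [e2]
  constructor
  · intro h
    have h1 : (L.take c).countP (· ≤ v) = c := by
      rw [List.countP_eq_length.2]
      · exact hl
      · intro a ha
        have := s3 a ha x List.mem_cons_self
        simp; omega
    rw [List.countP_cons_of_pos (by simpa using h)]
    omega
  · intro h
    by_contra hc
    have h1 : (x :: L.drop (c+1)).countP (· ≤ v) = 0 := by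
      rw [List.countP_eq_zero]
      intro a ha
      rcases List.mem_cons.1 ha with rfl | ha
      · simpa using hc
      · have := s2 a ha
        simp; omega
    have h2 : (L.take c).countP (· ≤ v) ≤ (L.take c).length := List.countP_le_length
    omega

theorem mem_wd {h : ℕ} {R : ℕ → List ℕ} {r a : ℕ} (hr : r < h) (ha : a ∈ R r) : a ∈ wd h R := by
  apply (wd_suffix (r+1) h hr R).subset
  simp [wd, ha]

theorem rect_of_tw {n w h : ℕ} {x : List ℕ} (hx : TW w h x) (hn : ∀ a ∈ x, a ≤ n) :
    ∃ T, IsRectTab n w h T ∧ rWord w h T = x := by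
  obtain ⟨R, hR, rfl⟩ := hx
  have hT : ∀ r c, (hr : r < h) → (hc : c < w) →
      (if r < h ∧ c < w then (R r).getD c 0 else 0) =
        (R r)[c]'(by rw [hR.len r hr]; exact hc) := by
    intro r c hr hc
    rw [if_pos ⟨hr, hc⟩]
    exact List.getD_eq_getElem _ _ _
  refine ⟨fun r c => if r < h ∧ c < w then (R r).getD c 0 else 0, ⟨?_, ?_, ?_, ?_⟩, ?_⟩
  · intro r c hrc
    simp only [if_neg hrc]
  · intro r c hr hc
    simp only [hT r c hr hc]
    exact ⟨hR.pos r hr _ (List.getElem_mem _), hn _ (mem_wd hr (List.getElem_mem _))⟩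
  · intro r c hr hc
    simp only [hT r c hr (by omega), hT r (c+1) hr hc]
    exact List.pairwise_iff_getElem.1 (hR.srt r hr) _ _ _ _ (by omega)
  · intro r c hr hc
    simp only [hT r c (by omega) hc, hT (r+1) c hr hc]
    have hp := hR.pos (r+1) hr _ (List.getElem_mem (by rw [hR.len (r+1) hr]; exact hc))
    obtain ⟨v, hv⟩ : ∃ v, (R (r+1))[c]'(by rw [hR.len (r+1) hr]; exact hc) = v + 1 :=
      ⟨_, (Nat.sub_add_cancel hp).symm⟩
    rw [hv]
    have h1 := (srt_get_le (hR.srt (r+1) hr) c (by rw [hR.len (r+1) hr]; exact hc) (v+1)).1 hv.le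
    have h2 := (srt_get_le (hR.srt r (by omega)) c (by rw [hR.len r (by omega)]; exact hc) v).2
      (h1.trans (hR.dom r hr v))
    omega
  · rw [rWord_eq]
    apply wd_congr
    intro r hr
    apply List.ext_getElem
    · simp [hR.len r hr]
    · intro c h1 h2
      simp only [List.getElem_map, List.getElem_range]
      exact hT r c hr (by simpa using h1)

theorem wd_inj {w h : ℕ} {R S : ℕ → List ℕ} (hR : TabF w h R) (hS : TabF w h S)
    (e : wd h R = wd h S) : ∀ r, r < h → R r = S r := by
  have : ∀ k, k ≤ h → wd k R = wd k S → ∀ r, r < k → R r = S r := by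
    intro k
    induction k with
    | zero => intro _ _ r hr; omega
    | succ k ih =>
      intro hk e r hr
      simp only [wd] at e
      obtain ⟨e1, e2⟩ := List.append_inj e (by rw [hR.len k hk, hS.len k hk])
      rcases Nat.lt_or_ge r k with h | h
      · exact ih (by omega) e2 r h
      · have : r = k := by omega
        rw [this, e1]
  exact this h le_rfl e

theorem rect_inj {n w h : ℕ} {T T' : ℕ → ℕ → ℕ} (hT : IsRectTab n w h T) (hT' : IsRectTab n w h T')
    (e : rWord w h T = rWord w h T') : T = T' := by
  rw [rWord_eq, rWord_eq] at e
  funext r c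
  by_cases hrc : r < h ∧ c < w
  · have := wd_inj (tabF_of_rect hT) (tabF_of_rect hT') e r hrc.1
    have h2 := List.map_inj_left.1 this c (by simpa using hrc.2)
    exact h2
  · rw [hT.1 r c hrc, hT'.1 r c hrc]

end SigmaAux

/-- Well-definedness of the isomorphism `σ`: for rectangular tableaux `p ∈ B_α`
(with `α = (w₁^{h₁})`) and `p' ∈ B_{α'}` (with `α' = (w₂^{h₂})`) there exist unique
`p̃' ∈ B_{α'}` and `p̃ ∈ B_α` with `p·p' = p̃'·p̃` (equality of plactic products,
i.e. Knuth equivalence of the concatenated row words). -/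
theorem sigma_well_defined (n w1 h1 w2 h2 : ℕ) (p p' : ℕ → ℕ → ℕ)
    (hp : IsRectTab n w1 h1 p) (hp' : IsRectTab n w2 h2 p') :
    ∃! pq : (ℕ → ℕ → ℕ) × (ℕ → ℕ → ℕ),
      IsRectTab n w2 h2 pq.1 ∧ IsRectTab n w1 h1 pq.2 ∧
        KnuthEquiv (rWord w2 h2 pq.1 ++ rWord w1 h1 pq.2)
          (rWord w1 h1 p ++ rWord w2 h2 p') := by
  obtain ⟨x, y, hx, hy, hk⟩ := SigmaAux.pair_exists _ _ _ le_rfl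
    (SigmaAux.tw_of_rect hp) (SigmaAux.tw_of_rect hp')
  have hn : ∀ a ∈ x ++ y, a ≤ n := by
    intro a ha
    rcases List.mem_append.1 ((SigmaAux.ke_perm hk).mem_iff.1 ha) with h | h
    · exact SigmaAux.rect_le hp a h
    · exact SigmaAux.rect_le hp' a h
  obtain ⟨T, hT, rfl⟩ := SigmaAux.rect_of_tw hx (fun a ha => hn a (List.mem_append_left _ ha))
  obtain ⟨T', hT', rfl⟩ := SigmaAux.rect_of_tw hy (fun a ha => hn a (List.mem_append_right _ ha))
  refine ⟨(T, T'), ⟨hT, hT', hk⟩, ?_⟩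
  rintro ⟨U, U'⟩ ⟨hU, hU', hk'⟩
  obtain ⟨e1, e2⟩ := SigmaAux.pair_uniq _ _ _ _ _ le_rfl (SigmaAux.tw_of_rect hU)
    (SigmaAux.tw_of_rect hU') (SigmaAux.tw_of_rect hT) (SigmaAux.tw_of_rect hT')
    (SigmaAux.ke_trans hk' (SigmaAux.ke_symm hk))
  exact Prod.ext (SigmaAux.rect_inj hU hT e1) (SigmaAux.rect_inj hU' hT' e2)
end
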